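/- Let I(t) = ∫₀^∞∫₀^∞∫₀^∞ [ (1+x₁+x₂+x₃)(1+x₁⁻¹+x₂⁻¹+x₃⁻¹) − t ]⁻¹ (dx₁/x₁)(dx₂/x₂)(dx₃/x₃). Then I(16) = 2·I(4) and I(16) = 8·(I(−2) − I(−32)). -/

import Mathlib

open MeasureTheory

/-- The three-banana Feynman integral `I(t)`. -/
noncomputable def feynmanI (t : ℝ) : ℝ :=
  ∫ x₁ in Set.Ioi (0 : ℝ), ∫ x₂ in Set.Ioi (0 : ℝ), ∫ x₃ in Set.Ioi (0 : ℝ),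
    ((1 + x₁ + x₂ + x₃) * (1 + x₁⁻¹ + x₂⁻¹ + x₃⁻¹) - t)⁻¹ / (x₁ * x₂ * x₃)

theorem differentiableAt_integral_of_norm_le {X : Type*} [MeasurableSpace X] {ν : Measure X}
    {F : ℂ → X → ℂ} {s₀ : ℂ} {R : ℝ} (hR : 0 < R) {g : X → ℝ} (hg : Integrable g ν)
    (hmeas : ∀ s ∈ Metric.ball s₀ R, AEStronglyMeasurable (F s) ν)
    (hF : ∀ᵐ x ∂ν, DifferentiableOn ℂ (F · x) (Metric.ball s₀ R))
    (hb : ∀ᵐ x ∂ν, ∀ s ∈ Metric.ball s₀ R, ‖F s x‖ ≤ g x) :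
    DifferentiableAt ℂ (fun s => ∫ x, F s x ∂ν) s₀ := by
  have hs₀ : s₀ ∈ Metric.ball s₀ R := Metric.mem_ball_self hR
  have hmeas_deriv : AEStronglyMeasurable (fun x => deriv (F · x) s₀) ν := by
    let u : ℕ → ℂ := fun n => ((R / 2 * (1 / ((n : ℝ) + 1)) : ℝ) : ℂ)
    have hu0 : ∀ n, u n ≠ 0 := fun n => by
      simp only [u, ne_eq, Complex.ofReal_eq_zero]; positivity
    have hut : Filter.Tendsto u Filter.atTop (nhdsWithin 0 {0}ᶜ) := by
      refine tendsto_nhdsWithin_iff.2 ⟨?_, Filter.Eventually.of_forall hu0⟩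
      have h := (tendsto_one_div_add_atTop_nhds_zero_nat (𝕜 := ℝ)).const_mul (R / 2)
      rw [mul_zero] at h
      exact (Complex.continuous_ofReal.tendsto' 0 0 Complex.ofReal_zero).comp h
    have hun : ∀ n, s₀ + u n ∈ Metric.ball s₀ R := fun n => by
      have h1 : 1 / ((n : ℝ) + 1) ≤ 1 := by
        rw [div_le_one (by positivity)]; linarith [n.cast_nonneg (α := ℝ)]
      have h2 : 0 < 1 / ((n : ℝ) + 1) := by positivity
      rw [Metric.mem_ball, dist_eq_norm, add_sub_cancel_left, Complex.norm_real, Real.norm_eq_abs,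
        abs_of_pos (by positivity)]
      nlinarith
    refine aestronglyMeasurable_of_tendsto_ae Filter.atTop
      (f := fun n x => (u n)⁻¹ • (F (s₀ + u n) x - F s₀ x)) (fun n => ?_) ?_
    · exact ((hmeas _ (hun n)).sub (hmeas _ hs₀)).const_smul (u n)⁻¹
    · filter_upwards [hF] with x hx
      have h := (hx.differentiableAt (Metric.ball_mem_nhds _ hR)).hasDerivAt
      exact h.tendsto_slope_zero.comp hut
  refine (hasDerivAt_integral_of_dominated_loc_of_deriv_le (F := F)
    (F' := fun s x => deriv (F · x) s) (s := Metric.ball s₀ (R / 2))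
    (bound := fun x => g x / (R / 3)) (Metric.ball_mem_nhds _ (by positivity)) ?_ ?_ hmeas_deriv
    ?_ (hg.div_const _) ?_).2.differentiableAt
  · exact Filter.mem_of_superset (Metric.ball_mem_nhds _ hR) hmeas
  · exact hg.mono' (hmeas _ hs₀) (hb.mono fun x hx => hx _ hs₀)
  · filter_upwards [hF, hb] with x hx hbx s hs
    have hsub : Metric.closedBall s (R / 3) ⊆ Metric.ball s₀ R := fun w hw => by
      rw [Metric.mem_ball] at *
      rw [Metric.mem_closedBall] at hw
      linarith [dist_triangle w s s₀]
    refine Complex.norm_deriv_le_of_forall_mem_sphere_norm_le (by positivity) ?_ ?_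
    · refine DifferentiableOn.diffContOnCl (hx.mono ?_)
      rwa [closure_ball _ (by positivity)]
    · exact fun w hw => hbx _ (hsub (Metric.sphere_subset_closedBall hw))
  · filter_upwards [hF] with x hx s hs
    have : s ∈ Metric.ball s₀ R := Metric.ball_subset_ball (by linarith) hs
    exact (hx.differentiableAt (Metric.isOpen_ball.mem_nhds this)).hasDerivAt

/-- The combination of three propagators `(D - α)⁻¹` that integrates to zero, in terms of
`e = D - 16`. -/
noncomputable def bananaKernel (e : ℝ) (s : ℂ) : ℂ :=
  1 / (e + 12 + 4 * s) -
    (e * (1 + s) / 2 + 16 * s) / (e ^ 2 + 16 * s * (1 + s) * e + 256 * s ^ 2)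

/-- The cone `|Im s| < Re s`. -/
def bananaCone : Set ℂ := {s | |s.im| < s.re}

theorem isOpen_bananaCone : IsOpen bananaCone :=
  isOpen_lt (by fun_prop) (by fun_prop)

theorem convex_bananaCone : Convex ℝ bananaCone := by
  intro x hx y hy a b ha hb hab
  simp only [bananaCone, Set.mem_ofPred_eq, abs_lt, Complex.add_re, Complex.add_im,
    Complex.real_smul, Complex.mul_re, Complex.mul_im, Complex.ofReal_re, Complex.ofReal_im,
    zero_mul, sub_zero, add_zero] at *
  rcases ha.eq_or_lt with rfl | ha
  · obtain rfl : b = 1 := by linarith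
    constructor <;> linarith
  · constructor <;> nlinarith

theorem le_re_bananaKernel_denom {e : ℝ} (he : 0 ≤ e) {s : ℂ} (hs : s ∈ bananaCone) :
    e ^ 2 + 256 * (s ^ 2).re ≤ ((e : ℂ) ^ 2 + 16 * s * (1 + s) * e + 256 * s ^ 2).re := by
  simp only [bananaCone, Set.mem_ofPred_eq, abs_lt] at hs
  have h : ((e : ℂ) ^ 2 + 16 * s * (1 + s) * e + 256 * s ^ 2) =
      ((e ^ 2 : ℝ) : ℂ) + ((16 * e : ℝ) : ℂ) * (s + s ^ 2) + ((256 : ℝ) : ℂ) * s ^ 2 := by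
    push_cast; ring
  have h2 : 0 ≤ (s ^ 2).re := by
    rw [pow_two, Complex.mul_re]; nlinarith
  rw [h, Complex.add_re, Complex.add_re, Complex.re_ofReal_mul, Complex.re_ofReal_mul,
    Complex.ofReal_re, Complex.add_re]
  have : 0 ≤ 16 * e * (s.re + (s ^ 2).re) := by
    have : 0 ≤ s.re := by linarith
    positivity
  linarith

theorem re_sq_pos_of_mem_bananaCone {s : ℂ} (hs : s ∈ bananaCone) : 0 < (s ^ 2).re := by
  simp only [bananaCone, Set.mem_ofPred_eq, abs_lt] at hs
  rw [pow_two, Complex.mul_re]; nlinarith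

theorem bananaKernel_denom_ne_zero {e : ℝ} (he : 0 ≤ e) {s : ℂ} (hs : s ∈ bananaCone) :
    (e : ℂ) ^ 2 + 16 * s * (1 + s) * e + 256 * s ^ 2 ≠ 0 := fun h => by
  have h1 := le_re_bananaKernel_denom he hs
  rw [h, Complex.zero_re] at h1
  have := re_sq_pos_of_mem_bananaCone hs
  nlinarith [sq_nonneg e]

theorem le_re_linear_denom {e : ℝ} {s : ℂ} (hs : s ∈ bananaCone) :
    e + 12 ≤ ((e : ℂ) + 12 + 4 * s).re := by
  simp only [bananaCone, Set.mem_ofPred_eq, abs_lt] at hs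
  have : ((e : ℂ) + 12 + 4 * s) = ((e + 12 : ℝ) : ℂ) + ((4 : ℝ) : ℂ) * s := by push_cast; ring
  rw [this, Complex.add_re, Complex.ofReal_re, Complex.re_ofReal_mul]
  linarith

theorem linear_denom_ne_zero {e : ℝ} (he : 0 ≤ e) {s : ℂ} (hs : s ∈ bananaCone) :
    (e : ℂ) + 12 + 4 * s ≠ 0 := fun h => by
  have h1 := le_re_linear_denom (e := e) hs
  rw [h, Complex.zero_re] at h1
  linarith

theorem differentiableOn_bananaKernel {e : ℝ} (he : 0 ≤ e) :
    DifferentiableOn ℂ (bananaKernel e) bananaCone := by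
  intro s hs
  have h1 := linear_denom_ne_zero he hs
  have h2 := bananaKernel_denom_ne_zero he hs
  unfold bananaKernel
  refine DifferentiableAt.differentiableWithinAt ?_
  fun_prop (disch := assumption)

theorem exists_ball_norm_bananaKernel_le {s₀ : ℂ} (hs₀ : s₀ ∈ bananaCone) :
    ∃ R > 0, ∃ C : ℝ, Metric.ball s₀ R ⊆ bananaCone ∧
      ∀ e : ℝ, 0 ≤ e → ∀ s ∈ Metric.ball s₀ R, ‖bananaKernel e s‖ ≤ C * (e + 16)⁻¹ := by
  have hpos := re_sq_pos_of_mem_bananaCone hs₀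
  obtain ⟨η, hη0, hη1, hη⟩ : ∃ η : ℝ, 0 < η ∧ η ≤ 1 ∧ η < (s₀ ^ 2).re := by
    refine ⟨min 1 ((s₀ ^ 2).re / 2), by positivity, min_le_left _ _, ?_⟩
    exact (min_le_right _ _).trans_lt (by linarith)
  have hopen : IsOpen (bananaCone ∩ {s : ℂ | η < (s ^ 2).re} ∩ {s : ℂ | ‖s‖ < ‖s₀‖ + 1}) :=
    (isOpen_bananaCone.inter (isOpen_lt (by fun_prop) (by fun_prop))).inter
      (isOpen_lt (by fun_prop) (by fun_prop))
  obtain ⟨R, hR, hsub⟩ := Metric.isOpen_iff.1 hopen s₀ ⟨⟨hs₀, hη⟩, by simp⟩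
  refine ⟨R, hR, 2 + 2 * (‖s₀‖ + 2) / η, fun s hs => (hsub hs).1.1, fun e he s hs => ?_⟩
  obtain ⟨⟨hsc, hsη⟩, hsn⟩ := hsub hs
  simp only [Set.mem_ofPred_eq] at hsη hsn
  have hA : ‖(1 : ℂ) / (e + 12 + 4 * s)‖ ≤ 2 * (e + 16)⁻¹ := by
    have h1 := (le_re_linear_denom (e := e) hsc).trans (Complex.re_le_norm _)
    rw [norm_div, norm_one, ← div_eq_mul_inv, div_le_div_iff₀ (by linarith) (by linarith)]
    linarith
  have hB : ‖((e : ℂ) * (1 + s) / 2 + 16 * s) /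
      (e ^ 2 + 16 * s * (1 + s) * e + 256 * s ^ 2)‖ ≤ 2 * (‖s₀‖ + 2) / η * (e + 16)⁻¹ := by
    have h1 := (le_re_bananaKernel_denom he hsc).trans (Complex.re_le_norm _)
    have h2 : ‖(e : ℂ) * (1 + s) / 2 + 16 * s‖ ≤ (e + 16) * (‖s₀‖ + 2) := by
      calc ‖(e : ℂ) * (1 + s) / 2 + 16 * s‖ ≤ ‖(e : ℂ) * (1 + s) / 2‖ + ‖16 * s‖ := norm_add_le _ _
        _ = e * ‖1 + s‖ / 2 + 16 * ‖s‖ := by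
          simp [abs_of_nonneg he]
        _ ≤ e * (1 + ‖s‖) / 2 + 16 * ‖s‖ := by
          gcongr
          exact (norm_add_le _ _).trans (by simp)
        _ ≤ (e + 16) * (‖s₀‖ + 2) := by
          nlinarith [norm_nonneg s, norm_nonneg s₀, mul_le_mul_of_nonneg_left hsn.le he,
            mul_nonneg he (norm_nonneg s)]
    have h3 : η / 2 * (e + 16) ^ 2 ≤
        ‖(e : ℂ) ^ 2 + 16 * s * (1 + s) * e + 256 * s ^ 2‖ := by
      refine le_trans ?_ h1
      nlinarith [sq_nonneg (e - 16), mul_nonneg (sub_nonneg.2 hη1) (sq_nonneg e)]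
    rw [norm_div]
    calc _ ≤ (e + 16) * (‖s₀‖ + 2) / (η / 2 * (e + 16) ^ 2) := by gcongr
      _ = _ := by field_simp
  calc ‖bananaKernel e s‖ ≤ _ := norm_sub_le _ _
    _ ≤ _ := add_le_add hA hB
    _ = _ := by ring

theorem measurable_bananaKernel (s : ℂ) : Measurable (fun e => bananaKernel e s) := by
  unfold bananaKernel
  fun_prop

theorem integrable_bananaKernel {m : Measure ℝ} (hm : ∀ᵐ e ∂m, 0 ≤ e)
    (hint : Integrable (fun e : ℝ => (e + 16)⁻¹) m) {s : ℂ} (hs : s ∈ bananaCone) :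
    Integrable (fun e => bananaKernel e s) m := by
  obtain ⟨R, hR, C, -, hb⟩ := exists_ball_norm_bananaKernel_le hs
  exact (hint.const_mul C).mono' (measurable_bananaKernel s).aestronglyMeasurable
    (hm.mono fun e he => hb e he s (Metric.mem_ball_self hR))

theorem integral_bananaKernel_eq_zero {m : Measure ℝ} (hm : ∀ᵐ e ∂m, 0 ≤ e)
    (hint : Integrable (fun e : ℝ => (e + 16)⁻¹) m) {δ : ℝ} (hδ : 0 < δ)
    (h0 : ∀ s : ℝ, 1 < s → s < 1 + δ → ∫ e, bananaKernel e s ∂m = 0) {s : ℝ} (hs : 0 < s) :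
    ∫ e, bananaKernel e s ∂m = 0 := by
  have hmem : ∀ {r : ℝ}, 0 < r → (r : ℂ) ∈ bananaCone := fun hr => by
    simpa [bananaCone] using hr
  have hd : DifferentiableOn ℂ (fun s : ℂ => ∫ e, bananaKernel e s ∂m) bananaCone := by
    intro s₀ hs₀
    obtain ⟨R, hR, C, hsub, hb⟩ := exists_ball_norm_bananaKernel_le hs₀
    refine (differentiableAt_integral_of_norm_le (F := fun s e => bananaKernel e s) hR
      (hint.const_mul C) (fun s _ => (measurable_bananaKernel s).aestronglyMeasurable)
      ?_ ?_).differentiableWithinAt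
    · exact hm.mono fun e he => (differentiableOn_bananaKernel he).mono hsub
    · exact hm.mono fun e he s hs => hb e he s hs
  have ha := hd.analyticOnNhd isOpen_bananaCone
  have hfreq : ∃ᶠ z in nhdsWithin (((1 + δ / 2 : ℝ)) : ℂ) {(((1 + δ / 2 : ℝ)) : ℂ)}ᶜ,
      ∫ e, bananaKernel e z ∂m = 0 := by
    have ht : Filter.Tendsto (fun r : ℝ => (r : ℂ)) (nhdsWithin (1 + δ / 2) {1 + δ / 2}ᶜ)
        (nhdsWithin (((1 + δ / 2 : ℝ)) : ℂ) {(((1 + δ / 2 : ℝ)) : ℂ)}ᶜ) := by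
      refine tendsto_nhdsWithin_iff.2
        ⟨(Complex.continuous_ofReal.tendsto _).mono_left nhdsWithin_le_nhds, ?_⟩
      filter_upwards [self_mem_nhdsWithin] with r hr
      simpa only [Set.mem_compl_iff, Set.mem_singleton_iff, Complex.ofReal_inj] using hr
    refine ht.frequently (Filter.Eventually.frequently ?_)
    refine nhdsWithin_le_nhds ?_
    filter_upwards [Ioo_mem_nhds (show (1 : ℝ) < 1 + δ / 2 by linarith)
      (show 1 + δ / 2 < 1 + δ by linarith)] with r hr
    exact h0 r hr.1 hr.2
  exact ha.eqOn_zero_of_preconnected_of_frequently_eq_zero convex_bananaCone.isPreconnected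
    (hmem (by linarith)) hfreq (hmem hs)

theorem bananaKernel_ofReal (e s : ℝ) :
    bananaKernel e s = ((1 / (e + 12 + 4 * s) -
      (e * (1 + s) / 2 + 16 * s) / (e ^ 2 + 16 * s * (1 + s) * e + 256 * s ^ 2) : ℝ) : ℂ) := by
  simp [bananaKernel]

theorem integrable_inv_add {m : Measure ℝ} (hm : ∀ᵐ e ∂m, 0 ≤ e)
    (hint : Integrable (fun e : ℝ => (e + 16)⁻¹) m) {a : ℝ} (ha : 0 < a) :
    Integrable (fun e : ℝ => (e + a)⁻¹) m := by
  refine (hint.const_mul (1 + 16 / a)).mono' (by fun_prop) (hm.mono fun e he => ?_)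
  have : 0 < e + a := by linarith
  rw [Real.norm_of_nonneg (by positivity), ← div_eq_mul_inv, inv_eq_one_div,
    div_le_div_iff₀ this (by linarith)]
  have : (1 + 16 / a) * (e + a) = e + 16 + (a + 16 * e / a) := by field_simp; ring
  rw [this]
  have : 0 ≤ 16 * e / a := by positivity
  linarith

/-- If `∫ bananaKernel e s` vanishes on a right neighbourhood of `s = 1`, then the values at
`s = 3 / 2` and `s → 0` give linear relations between the integrals of `(e + a)⁻¹`. -/
theorem integral_inv_add_relations {m : Measure ℝ} (hm : ∀ᵐ e ∂m, 0 < e)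
    (hint : Integrable (fun e : ℝ => (e + 16)⁻¹) m) {δ : ℝ} (hδ : 0 < δ)
    (h0 : ∀ s : ℝ, 1 < s → s < 1 + δ → ∫ e, (1 / (e + 12 + 4 * s) -
      (e * (1 + s) / 2 + 16 * s) / (e ^ 2 + 16 * s * (1 + s) * e + 256 * s ^ 2)) ∂m = 0) :
    Integrable (fun e : ℝ => e⁻¹) m ∧
    ∫ e, e⁻¹ ∂m = 2 * ∫ e, (e + 12)⁻¹ ∂m ∧
    ∫ e, (e + 18)⁻¹ ∂m = ∫ e, (e + 48)⁻¹ ∂m + 1 / 4 * ∫ e, (e + 12)⁻¹ ∂m := by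
  have hm' : ∀ᵐ e ∂m, 0 ≤ e := hm.mono fun e he => he.le
  have hcone : ∀ {s : ℝ}, 0 < s → (s : ℂ) ∈ bananaCone := fun hr => by
    simpa [bananaCone] using hr
  let g : ℝ → ℝ → ℝ := fun s e =>
    (e * (1 + s) / 2 + 16 * s) / (e ^ 2 + 16 * s * (1 + s) * e + 256 * s ^ 2)
  have hlin : ∀ {s : ℝ}, 0 < s → Integrable (fun e : ℝ => 1 / (e + 12 + 4 * s)) m := by
    intro s hs
    simpa only [one_div, add_assoc] using
      integrable_inv_add hm' hint (show 0 < 12 + 4 * s by linarith)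
  have hg : ∀ {s : ℝ}, 0 < s → Integrable (g s) m := fun {s} hs => by
    have h := (integrable_bananaKernel hm' hint (hcone hs)).re
    simp only [bananaKernel_ofReal] at h
    refine ((hlin hs).sub h).congr (Filter.Eventually.of_forall fun e => ?_)
    simp only [g, Pi.sub_apply, RCLike.re_eq_complex_re, Complex.ofReal_re]
    ring
  have hgI : ∀ {s : ℝ}, 0 < s → ∫ e, g s e ∂m = ∫ e, 1 / (e + 12 + 4 * s) ∂m := fun {s} hs => by
    have h := integral_bananaKernel_eq_zero hm' hint hδ (fun s h1 h2 => by
      simp only [bananaKernel_ofReal]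
      rw [integral_complex_ofReal, h0 s h1 h2, Complex.ofReal_zero]) hs
    simp only [bananaKernel_ofReal] at h
    rw [integral_complex_ofReal, Complex.ofReal_eq_zero, integral_sub (hlin hs) (hg hs)] at h
    linarith
  let u : ℕ → ℝ := fun n => 1 / ((n : ℝ) + 1)
  have hu0 : ∀ n, 0 < u n := fun n => by positivity
  have hut : Filter.Tendsto u Filter.atTop (nhds 0) := tendsto_one_div_add_atTop_nhds_zero_nat
  have hlim : ∀ᵐ e ∂m, Filter.Tendsto (fun n => g (u n) e) Filter.atTop (nhds (1 / 2 * e⁻¹)) := by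
    filter_upwards [hm] with e he
    have hc : ContinuousAt (fun s => g s e) 0 := by
      refine ContinuousAt.div (by fun_prop) (by fun_prop) ?_
      simp [he.ne']
    have h0 : g 0 e = 1 / 2 * e⁻¹ := by
      simp only [g]
      field_simp
      simp
    rw [← h0]
    exact hc.tendsto.comp hut
  have hbound : ∀ {s : ℝ}, 0 < s → s ≤ 1 → ∀ {e : ℝ}, 0 < e → ‖g s e‖ ≤ e⁻¹ := by
    intro s hs hs1 e he
    simp only [g]
    rw [Real.norm_of_nonneg (by positivity), inv_eq_one_div,
      div_le_div_iff₀ (by positivity) he]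
    nlinarith [mul_pos hs he, mul_pos (mul_pos hs hs) he, mul_pos hs (mul_pos he he),
      mul_nonneg (sub_nonneg.2 hs1) (mul_pos he he).le]
  have hI12 := integrable_inv_add hm' hint (show (0 : ℝ) < 12 by norm_num)
  have hgle : ∀ {s : ℝ}, 0 < s → ∫ e, g s e ∂m ≤ ∫ e, (e + 12)⁻¹ ∂m := fun {s} hs => by
    rw [hgI hs]
    refine integral_mono_ae (hlin hs) hI12 (hm.mono fun e he => ?_)
    simp only
    rw [inv_eq_one_div]
    exact one_div_le_one_div_of_le (by positivity) (by linarith)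
  have hIhalf : Integrable (fun e : ℝ => 1 / 2 * e⁻¹) m := by
    refine integrable_of_tendsto hlim (fun n => (hg (hu0 n)).aestronglyMeasurable) ?_
    refine ne_top_of_le_ne_top (b := ENNReal.ofReal (∫ e, (e + 12)⁻¹ ∂m)) ENNReal.ofReal_ne_top ?_
    refine Filter.liminf_le_of_le (by isBoundedDefault) fun b hb => ?_
    obtain ⟨n, hn⟩ := hb.exists
    refine hn.trans ?_
    have hnn : ∀ᵐ e ∂m, 0 ≤ g (u n) e := hm.mono fun e he => by
      have := hu0 n
      simp only [g]; positivity
    rw [← ofReal_integral_norm_eq_lintegral_enorm (hg (hu0 n))]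
    refine ENNReal.ofReal_le_ofReal ?_
    rw [integral_congr_ae (hnn.mono fun e he => Real.norm_of_nonneg he)]
    exact hgle (hu0 n)
  have hI : Integrable (fun e : ℝ => e⁻¹) m := by
    refine (hIhalf.const_mul 2).congr (Filter.Eventually.of_forall fun e => ?_)
    simp
  refine ⟨hI, ?_, ?_⟩
  · have h1 : Filter.Tendsto (fun n => ∫ e, g (u n) e ∂m) Filter.atTop
        (nhds (∫ e, 1 / 2 * e⁻¹ ∂m)) := by
      refine tendsto_integral_of_dominated_convergence (fun e => e⁻¹)
        (fun n => (hg (hu0 n)).aestronglyMeasurable) hI (fun n => ?_) hlim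
      filter_upwards [hm] with e he
      refine hbound (hu0 n) ?_ he
      rw [div_le_one (by positivity)]
      linarith [n.cast_nonneg (α := ℝ)]
    have h2 : Filter.Tendsto (fun n => ∫ e, 1 / (e + 12 + 4 * u n) ∂m) Filter.atTop
        (nhds (∫ e, (e + 12)⁻¹ ∂m)) := by
      refine tendsto_integral_of_dominated_convergence (fun e => (e + 12)⁻¹)
        (fun n => (hlin (hu0 n)).aestronglyMeasurable) hI12 (fun n => ?_) ?_
      · filter_upwards [hm] with e he
        have := hu0 n
        rw [Real.norm_of_nonneg (by positivity), inv_eq_one_div]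
        exact one_div_le_one_div_of_le (by positivity) (by linarith)
      · filter_upwards [hm] with e he
        have hc : ContinuousAt (fun s : ℝ => 1 / (e + 12 + 4 * s)) 0 := by
          refine ContinuousAt.div (by fun_prop) (by fun_prop) ?_
          simp only [mul_zero, add_zero]
          positivity
        have h0 : (e + 12)⁻¹ = 1 / (e + 12 + 4 * 0) := by simp
        rw [h0]
        exact hc.tendsto.comp hut
    have h3 := tendsto_nhds_unique h1 (h2.congr fun n => (hgI (hu0 n)).symm)
    rw [integral_const_mul] at h3
    linarith
  · have h := hgI (show (0 : ℝ) < 3 / 2 by norm_num)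
    have hsplit : ∀ᵐ e ∂m, g (3 / 2) e = (e + 48)⁻¹ + 1 / 4 * (e + 12)⁻¹ := by
      filter_upwards [hm] with e he
      simp only [g]
      field_simp
      ring
    rw [integral_congr_ae hsplit, integral_add
      (integrable_inv_add hm' hint (by norm_num)) (hI12.const_mul _), integral_const_mul] at h
    rw [h]
    congr 1 with e
    rw [one_div]
    congr 1
    ring

/-- The power series `∑ nʲ cₙ tⁿ`. -/
noncomputable def thetaSeries (c : ℕ → ℝ) (j : ℕ) (t : ℝ) : ℝ :=
  ∑' n : ℕ, (n : ℝ) ^ j * c n * t ^ n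

theorem norm_pow_mul_le_of_geometric {c : ℕ → ℝ} {B : ℝ} (hc : ∀ n, |c n| ≤ B * (1 / 16) ^ n)
    (j n : ℕ) {t : ℝ} (ht : |t| ≤ 8) :
    ‖(n : ℝ) ^ j * c n * t ^ n‖ ≤ B * ((n : ℝ) ^ j * (1 / 2) ^ n) := by
  have h1 : |t| ^ n ≤ 8 ^ n := pow_le_pow_left₀ (abs_nonneg t) ht n
  have h2 : ((1 : ℝ) / 2) ^ n = (1 / 16) ^ n * 8 ^ n := by rw [← mul_pow]; norm_num
  rw [norm_mul, norm_mul, norm_pow, norm_pow, Real.norm_eq_abs, Real.norm_eq_abs, Real.norm_eq_abs,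
    Nat.abs_cast, h2]
  calc (n : ℝ) ^ j * |c n| * |t| ^ n ≤ (n : ℝ) ^ j * (B * (1 / 16) ^ n) * 8 ^ n := by
        have hB : 0 ≤ B * (1 / 16) ^ n := (abs_nonneg _).trans (hc n)
        gcongr
        exact hc n
    _ = _ := by ring

theorem summable_pow_mul_half (B : ℝ) (j : ℕ) :
    Summable (fun n : ℕ => B * ((n : ℝ) ^ j * (1 / 2) ^ n)) :=
  (summable_pow_mul_geometric_of_norm_lt_one j
    (by rw [Real.norm_of_nonneg] <;> norm_num)).mul_left B

theorem hasSum_thetaSeries {c : ℕ → ℝ} {B : ℝ} (hc : ∀ n, |c n| ≤ B * (1 / 16) ^ n)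
    (j : ℕ) {t : ℝ} (ht : |t| ≤ 8) :
    HasSum (fun n : ℕ => (n : ℝ) ^ j * c n * t ^ n) (thetaSeries c j t) :=
  (Summable.of_norm_bounded (summable_pow_mul_half B j)
    fun n => norm_pow_mul_le_of_geometric hc j n ht).hasSum

theorem exists_hasDerivAt_thetaSeries {c : ℕ → ℝ} {B : ℝ} (hc : ∀ n, |c n| ≤ B * (1 / 16) ^ n)
    (j : ℕ) {t : ℝ} (ht : |t| < 8) :
    ∃ d, HasDerivAt (thetaSeries c j) d t ∧ t * d = thetaSeries c (j + 1) t := by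
  refine ⟨∑' n : ℕ, (n : ℝ) ^ j * c n * (n * t ^ (n - 1)), ?_, ?_⟩
  · refine hasDerivAt_tsum_of_isPreconnected (summable_pow_mul_half B (j + 1))
      (t := Metric.ball (0 : ℝ) 8) (y₀ := 0) Metric.isOpen_ball
      (convex_ball _ _).isPreconnected (fun n y _ => (hasDerivAt_pow n y).const_mul _)
      (fun n y hy => ?_) (by simp) (hasSum_thetaSeries hc j (by norm_num)).summable
      (by simpa using ht)
    rw [Metric.mem_ball, dist_zero_right] at hy
    rcases n with _ | n
    · simp
    · have h1 : |y| ^ n ≤ 8 ^ n := pow_le_pow_left₀ (abs_nonneg y) hy.le n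
      have h2 : ((1 : ℝ) / 2) ^ (n + 1) = (1 / 16) ^ (n + 1) * (8 * 8 ^ n) := by
        rw [← pow_succ', ← mul_pow]; norm_num
      rw [norm_mul, norm_mul, norm_mul, norm_pow, norm_pow, Real.norm_eq_abs, Real.norm_eq_abs,
        Real.norm_eq_abs, Nat.abs_cast, h2, Nat.add_sub_cancel]
      have hB : 0 ≤ B * (1 / 16) ^ (n + 1) := (abs_nonneg _).trans (hc (n + 1))
      calc ((n + 1 : ℕ) : ℝ) ^ j * |c (n + 1)| * (((n + 1 : ℕ) : ℝ) * |y| ^ n)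
          ≤ ((n + 1 : ℕ) : ℝ) ^ j * (B * (1 / 16) ^ (n + 1)) * (((n + 1 : ℕ) : ℝ) * 8 ^ n) := by
            gcongr
            exact hc (n + 1)
        _ ≤ ((n + 1 : ℕ) : ℝ) ^ j * (B * (1 / 16) ^ (n + 1)) *
              (((n + 1 : ℕ) : ℝ) * (8 * 8 ^ n)) := by
            gcongr
            linarith [show (0 : ℝ) < 8 ^ n by positivity]
        _ = _ := by ring
  · rw [← tsum_mul_left, thetaSeries]
    refine tsum_congr fun n => ?_
    rcases n with _ | n
    · simp
    · rw [Nat.add_sub_cancel]; ring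

theorem hasDerivAt_thetaSeries {c : ℕ → ℝ} {B : ℝ} (hc : ∀ n, |c n| ≤ B * (1 / 16) ^ n)
    (j : ℕ) {t : ℝ} (ht : |t| < 8) (ht0 : t ≠ 0) :
    HasDerivAt (thetaSeries c j) (thetaSeries c (j + 1) t / t) t := by
  obtain ⟨d, hd, h⟩ := exists_hasDerivAt_thetaSeries hc j ht
  rwa [← h, mul_div_cancel_left₀ _ ht0]

theorem thetaSeries_succ_zero (c : ℕ → ℝ) (j : ℕ) : thetaSeries c (j + 1) 0 = 0 := by
  rw [thetaSeries]
  convert tsum_zero with n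
  rcases n with _ | n <;> simp

theorem thetaSeries_ode {c : ℕ → ℝ} {B : ℝ} (hc : ∀ n, |c n| ≤ B * (1 / 16) ^ n)
    (hrec : ∀ n : ℕ, 64 * ((n : ℝ) + 2) ^ 3 * c (n + 2) -
      2 * (2 * n + 3) * (5 * ((n : ℝ) + 1) ^ 2 + 5 * (n + 1) + 2) * c (n + 1) +
      ((n : ℝ) + 1) ^ 3 * c n = 0) {t : ℝ} (ht : |t| ≤ 8) :
    (64 - 20 * t + t ^ 2) * thetaSeries c 3 t = (64 * c 1 - 4 * c 0) * t +
      (30 * t - 3 * t ^ 2) * thetaSeries c 2 t + (18 * t - 3 * t ^ 2) * thetaSeries c 1 t +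
      (4 * t - t ^ 2) * thetaSeries c 0 t := by
  have h0 := fun j => hasSum_thetaSeries hc j ht
  have h1 := fun j => (hasSum_nat_add_iff' 1).2 (h0 j)
  have h2 := fun j => (hasSum_nat_add_iff' 2).2 (h0 j)
  have H := (((h2 3).mul_left 64).sub (((((h1 3).mul_left 20).add ((h1 2).mul_left 30)).add
    ((h1 1).mul_left 18)).add ((h1 0).mul_left 4) |>.mul_left t)).add
    (((((h0 3).add ((h0 2).mul_left 3)).add ((h0 1).mul_left 3)).add (h0 0)).mul_left (t ^ 2))
  have H0 := H.unique (hasSum_zero.congr_fun fun n => ?_)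
  · simp [Finset.sum_range_succ] at H0
    linear_combination H0
  · push_cast
    linear_combination t ^ (n + 2) * hrec n

/-- Uniqueness for a third order equation with a regular singular point at `0`, written in terms of
`θ = z d/dz`, among solutions vanishing at `0`. -/
theorem eq_zero_of_theta_ode {Y₀ Y₁ Y₂ m₀ m₁ m₂ : ℝ → ℝ} {δ : ℝ}
    (h₀ : ∀ z, 0 < z → z < δ → HasDerivAt Y₀ (Y₁ z / z) z)
    (h₁ : ∀ z, 0 < z → z < δ → HasDerivAt Y₁ (Y₂ z / z) z)
    (h₂ : ∀ z, 0 < z → z < δ →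
      HasDerivAt Y₂ (-(m₂ z * Y₂ z + m₁ z * Y₁ z + m₀ z * Y₀ z) / z) z)
    (hm : ∀ z, 0 < z → z < δ → |m₀ z| ≤ 1 / 50 ∧ |m₁ z| ≤ 1 / 50 ∧ |m₂ z| ≤ 1 / 50)
    (hd₀ : DifferentiableAt ℝ Y₀ 0) (hd₁ : DifferentiableAt ℝ Y₁ 0)
    (hd₂ : DifferentiableAt ℝ Y₂ 0) (hz₀ : Y₀ 0 = 0) (hz₁ : Y₁ 0 = 0) (hz₂ : Y₂ 0 = 0)
    {z : ℝ} (hz : 0 < z) (hzδ : z < δ) : Y₀ z = 0 := by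
  let E : ℝ → ℝ := fun z => Y₀ z ^ 2 + 16 * Y₁ z ^ 2 + 256 * Y₂ z ^ 2
  have hE0 : ∀ z, 0 ≤ E z := fun z => by positivity
  have hEd : HasDerivAt E 0 0 := by
    have h := ((hd₀.hasDerivAt.pow 2).add ((hd₁.hasDerivAt.pow 2).const_mul 16)).add
      ((hd₂.hasDerivAt.pow 2).const_mul 256)
    exact h.congr_deriv (by simp [hz₀, hz₁, hz₂])
  have hE00 : E 0 = 0 := by simp [E, hz₀, hz₁, hz₂]
  have hlim : Filter.Tendsto (fun z => E z / z) (nhdsWithin 0 (Set.Ioi 0)) (nhds 0) := by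
    have h := hEd.tendsto_slope_zero_right
    refine h.congr fun t => ?_
    simp [hE00, div_eq_inv_mul]
  have hder : ∀ z, 0 < z → z < δ → ∃ d ≤ 0, HasDerivAt (fun z => E z / z) d z := by
    intro z hz hzδ
    have h := (((h₀ z hz hzδ).pow 2).add (((h₁ z hz hzδ).pow 2).const_mul 16)).add
      (((h₂ z hz hzδ).pow 2).const_mul 256)
    refine ⟨_, ?_, h.div (hasDerivAt_id z) hz.ne'⟩
    refine div_nonpos_of_nonpos_of_nonneg ?_ (by positivity)
    obtain ⟨b0, b1, b2⟩ := hm z hz hzδ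
    rw [abs_le] at b0 b1 b2
    simp only [Pi.add_apply, Pi.pow_apply, Nat.cast_ofNat]
    have key : ∀ {m : ℝ}, -(1 / 50) ≤ m ∧ m ≤ 1 / 50 → ∀ x y : ℝ,
        m * (x * y) ≤ 1 / 100 * (x ^ 2 + y ^ 2) := fun {m} hm x y => by
      nlinarith [mul_nonneg (sub_nonneg.2 hm.2) (sq_nonneg (x + y)),
        mul_nonneg (sub_nonneg.2 hm.1) (sq_nonneg (x - y))]
    have k0 := key (m := -m₀ z) ⟨by linarith, by linarith⟩ (Y₀ z) (16 * Y₂ z)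
    have k1 := key (m := -m₁ z) ⟨by linarith, by linarith⟩ (4 * Y₁ z) (16 * Y₂ z)
    have k2 := key (m := -m₂ z) ⟨by linarith, by linarith⟩ (16 * Y₂ z) (16 * Y₂ z)
    have e : (2 * Y₀ z ^ (2 - 1) * (Y₁ z / z) + 16 * (2 * Y₁ z ^ (2 - 1) * (Y₂ z / z)) +
        256 * (2 * Y₂ z ^ (2 - 1) * (-(m₂ z * Y₂ z + m₁ z * Y₁ z + m₀ z * Y₀ z) / z))) * z =
        2 * Y₀ z * Y₁ z + 32 * Y₁ z * Y₂ z -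
          512 * Y₂ z * (m₂ z * Y₂ z + m₁ z * Y₁ z + m₀ z * Y₀ z) := by
      field_simp
      ring
    rw [e]
    nlinarith [sq_nonneg (Y₀ z - 4 * Y₁ z), sq_nonneg (4 * Y₁ z - 16 * Y₂ z)]
  have hanti : AntitoneOn (fun z => E z / z) (Set.Ioo 0 δ) := by
    refine antitoneOn_of_deriv_nonpos (convex_Ioo 0 δ) (fun z hz => ?_) (fun z hz => ?_)
      (fun z hz => ?_)
    · obtain ⟨d, -, hd⟩ := hder z hz.1 hz.2
      exact hd.continuousAt.continuousWithinAt
    · rw [interior_Ioo] at hz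
      obtain ⟨d, -, hd⟩ := hder z hz.1 hz.2
      exact hd.differentiableAt.differentiableWithinAt
    · rw [interior_Ioo] at hz
      obtain ⟨d, hd0, hd⟩ := hder z hz.1 hz.2
      rwa [hd.deriv]
  have hle : E z / z ≤ 0 := by
    refine ge_of_tendsto hlim ?_
    filter_upwards [Ioo_mem_nhdsGT hz] with w hw
    exact hanti ⟨hw.1, hw.2.trans hzδ⟩ ⟨hz, hzδ⟩ hw.2.le
  have hEz : E z ≤ 0 := by
    rw [div_le_iff₀ hz, zero_mul] at hle
    exact hle
  have : Y₀ z ^ 2 ≤ 0 := by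
    simp only [E] at hEz
    nlinarith [sq_nonneg (Y₁ z), sq_nonneg (Y₂ z)]
  exact pow_eq_zero_iff two_ne_zero |>.1 (le_antisymm this (sq_nonneg _))

theorem hasDerivAt_theta_comp {F : ℕ → ℝ → ℝ} {α ρ ρ₁ p p₁ p₂ : ℝ → ℝ} {ρ₂ p₃ z : ℝ}
    (hF : ∀ j, HasDerivAt (F j) (F (j + 1) (α z) / α z) (α z)) (hα0 : α z ≠ 0)
    (hα : HasDerivAt α (α z * ρ z / z) z) (hρ : HasDerivAt ρ (ρ₁ z / z) z)
    (hρ₁ : HasDerivAt ρ₁ (ρ₂ / z) z) (hp : HasDerivAt p (p₁ z / z) z)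
    (hp₁ : HasDerivAt p₁ (p₂ z / z) z) (hp₂ : HasDerivAt p₂ (p₃ / z) z) :
    HasDerivAt (fun z => p z * F 0 (α z))
      ((p₁ z * F 0 (α z) + p z * ρ z * F 1 (α z)) / z) z ∧
    HasDerivAt (fun z => p₁ z * F 0 (α z) + p z * ρ z * F 1 (α z))
      ((p₂ z * F 0 (α z) + (2 * p₁ z * ρ z + p z * ρ₁ z) * F 1 (α z) +
        p z * ρ z ^ 2 * F 2 (α z)) / z) z ∧
    HasDerivAt (fun z => p₂ z * F 0 (α z) + (2 * p₁ z * ρ z + p z * ρ₁ z) * F 1 (α z) +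
        p z * ρ z ^ 2 * F 2 (α z))
      ((p₃ * F 0 (α z) + (3 * p₂ z * ρ z + 3 * p₁ z * ρ₁ z + p z * ρ₂) * F 1 (α z) +
        (3 * p₁ z * ρ z ^ 2 + 3 * p z * ρ z * ρ₁ z) * F 2 (α z) +
        p z * ρ z ^ 3 * F 3 (α z)) / z) z := by
  have hcomp : ∀ j, HasDerivAt (fun z => F j (α z)) (F (j + 1) (α z) * ρ z / z) z := fun j => by
    have h := (hF j).comp z hα
    refine h.congr_deriv ?_
    field_simp
  refine ⟨?_, ?_, ?_⟩
  · refine (hp.mul (hcomp 0)).congr_deriv ?_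
    ring
  · refine ((hp₁.mul (hcomp 0)).add ((hp.mul hρ).mul (hcomp 1))).congr_deriv ?_
    simp only [Pi.mul_apply]
    ring
  · refine (((hp₂.mul (hcomp 0)).add ((((hp₁.const_mul 2).mul hρ).add (hp.mul hρ₁)).mul
      (hcomp 1))).add ((hp.mul (hρ.pow 2)).mul (hcomp 2))).congr_deriv ?_
    simp only [Pi.mul_apply, Pi.add_apply, Pi.pow_apply]
    ring

theorem thetaSeries_functional_equation {c : ℕ → ℝ} {B : ℝ}
    (hc : ∀ n, |c n| ≤ B * (1 / 16) ^ n)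
    (hrec : ∀ n : ℕ, 64 * ((n : ℝ) + 2) ^ 3 * c (n + 2) -
      2 * (2 * n + 3) * (5 * ((n : ℝ) + 1) ^ 2 + 5 * (n + 1) + 2) * c (n + 1) +
      ((n : ℝ) + 1) ^ 3 * c n = 0) {z : ℝ} (hz : 0 < z) (hz1 : z < 1 / 100) :
    thetaSeries c 0 (-4 * z ^ 2 / (1 + z)) -
      1 / 2 * ((1 + z) * thetaSeries c 0 (-16 * z * (1 + z)) +
        1 / (1 + z) * thetaSeries c 0 (16 * z / (1 + z) ^ 2)) = 0 := by
  set F := thetaSeries c with hFdef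
  set α : ℝ → ℝ := fun z => -4 * z ^ 2 / (1 + z) with hα
  set β : ℝ → ℝ := fun z => -16 * z * (1 + z) with hβ
  set γ : ℝ → ℝ := fun z => 16 * z / (1 + z) ^ 2 with hγ
  have hne : ∀ {z : ℝ}, 0 < z → 1 + z ≠ 0 := fun h => by positivity
  have hα8 : ∀ {z : ℝ}, 0 < z → z < 1 / 100 → |α z| < 8 := fun {z} h h1 => by
    have : 0 < 1 + z := by linarith
    rw [hα, abs_lt]
    constructor
    · simp only; rw [lt_div_iff₀ this]; nlinarith
    · simp only; rw [div_lt_iff₀ this]; nlinarith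
  have hβ8 : ∀ {z : ℝ}, 0 < z → z < 1 / 100 → |β z| < 8 := fun {z} h h1 => by
    rw [hβ, abs_lt]
    constructor <;> simp only <;> nlinarith
  have hγ8 : ∀ {z : ℝ}, 0 < z → z < 1 / 100 → |γ z| < 8 := fun {z} h h1 => by
    have : 0 < 1 + z := by linarith
    rw [hγ, abs_lt]
    constructor
    · simp only; rw [lt_div_iff₀ (by positivity)]; nlinarith
    · simp only; rw [div_lt_iff₀ (by positivity)]; nlinarith
  have hα0 : ∀ {z : ℝ}, 0 < z → α z ≠ 0 := fun {z} h => by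
    have := hne h
    simp only [hα]
    exact div_ne_zero (by nlinarith) this
  have hβ0 : ∀ {z : ℝ}, 0 < z → β z ≠ 0 := fun {z} h => by
    simp only [hβ]; nlinarith
  have hγ0 : ∀ {z : ℝ}, 0 < z → γ z ≠ 0 := fun {z} h => by
    simp only [hγ]; positivity
  have hi : ∀ {z : ℝ}, 0 < z → HasDerivAt (fun z : ℝ => 1 + z) 1 z := fun {z} _ =>
    (hasDerivAt_id z).const_add 1
  have hi2 : ∀ {z : ℝ}, HasDerivAt (fun z : ℝ => 1 - z) (-1) z := fun {z} =>
    (hasDerivAt_id z).const_sub 1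
  have hA := fun (z : ℝ) (h : 0 < z) (h1 : z < 1 / 100) =>
    hasDerivAt_theta_comp (F := F) (α := α) (ρ := fun z => (2 + z) / (1 + z))
      (ρ₁ := fun z => -z / (1 + z) ^ 2) (ρ₂ := -z * (1 - z) / (1 + z) ^ 3)
      (p := fun _ => 1) (p₁ := fun _ => 0) (p₂ := fun _ => 0) (p₃ := 0) (z := z)
      (fun j => hasDerivAt_thetaSeries hc j (hα8 h h1) (hα0 h)) (hα0 h)
      ((((hasDerivAt_pow 2 z).const_mul (-4)).div (hi h) (hne h)).congr_deriv
        (by simp only [hα]; field_simp [hne h]; ring))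
      ((((hasDerivAt_id z).const_add 2).div (hi h) (hne h)).congr_deriv
        (by simp only [id]; field_simp [hne h]; ring))
      (((hasDerivAt_id z).neg.div ((hi h).pow 2) (pow_ne_zero 2 (hne h))).congr_deriv
        (by simp only [Pi.pow_apply, Pi.neg_apply, id]; field_simp [hne h]; ring))
      ((hasDerivAt_const z _).congr_deriv (by simp)) ((hasDerivAt_const z _).congr_deriv (by simp))
      ((hasDerivAt_const z _).congr_deriv (by simp))
  have hB := fun (z : ℝ) (h : 0 < z) (h1 : z < 1 / 100) =>
    hasDerivAt_theta_comp (F := F) (α := β) (ρ := fun z => (1 + 2 * z) / (1 + z))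
      (ρ₁ := fun z => z / (1 + z) ^ 2) (ρ₂ := z * (1 - z) / (1 + z) ^ 3)
      (p := fun z => 1 + z) (p₁ := fun z => z) (p₂ := fun z => z) (p₃ := z) (z := z)
      (fun j => hasDerivAt_thetaSeries hc j (hβ8 h h1) (hβ0 h)) (hβ0 h)
      ((((hasDerivAt_id z).const_mul (-16)).mul (hi h)).congr_deriv
        (by simp only [hβ, id]; field_simp [hne h]; ring))
      (((((hasDerivAt_id z).const_mul 2).const_add 1).div (hi h) (hne h)).congr_deriv
        (by simp only [id]; field_simp [hne h]; ring))
      (((hasDerivAt_id z).div ((hi h).pow 2) (pow_ne_zero 2 (hne h))).congr_deriv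
        (by simp only [Pi.pow_apply, id]; field_simp [hne h]; ring))
      ((hi h).congr_deriv (by field_simp)) ((hasDerivAt_id z).congr_deriv (by field_simp))
      ((hasDerivAt_id z).congr_deriv (by field_simp))
  have hC := fun (z : ℝ) (h : 0 < z) (h1 : z < 1 / 100) =>
    hasDerivAt_theta_comp (F := F) (α := γ) (ρ := fun z => (1 - z) / (1 + z))
      (ρ₁ := fun z => -(2 * z) / (1 + z) ^ 2) (ρ₂ := -(2 * z) * (1 - z) / (1 + z) ^ 3)
      (p := fun z => 1 / (1 + z)) (p₁ := fun z => -z / (1 + z) ^ 2)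
      (p₂ := fun z => -(z * (1 - z)) / (1 + z) ^ 3)
      (p₃ := -z * (1 - 4 * z + z ^ 2) / (1 + z) ^ 4) (z := z)
      (fun j => hasDerivAt_thetaSeries hc j (hγ8 h h1) (hγ0 h)) (hγ0 h)
      ((((hasDerivAt_id z).const_mul 16).div ((hi h).pow 2) (pow_ne_zero 2 (hne h))).congr_deriv
        (by simp only [hγ, Pi.pow_apply, id]; field_simp [hne h]; ring))
      ((hi2.div (hi h) (hne h)).congr_deriv (by field_simp [hne h]; ring))
      ((((hasDerivAt_id z).const_mul 2).neg.div ((hi h).pow 2) (pow_ne_zero 2 (hne h))).congr_deriv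
        (by simp only [Pi.pow_apply, Pi.neg_apply, id]; field_simp [hne h]; ring))
      (((hasDerivAt_const z (1 : ℝ)).div (hi h) (hne h)).congr_deriv (by field_simp [hne h]; ring))
      (((hasDerivAt_id z).neg.div ((hi h).pow 2) (pow_ne_zero 2 (hne h))).congr_deriv
        (by simp only [Pi.pow_apply, Pi.neg_apply, id]; field_simp [hne h]; ring))
      ((((hasDerivAt_id z).mul hi2).neg.div ((hi h).pow 3) (pow_ne_zero 3 (hne h))).congr_deriv
        (by simp only [Pi.pow_apply, Pi.neg_apply, Pi.mul_apply, id]; field_simp [hne h]; ring))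
  have hF0 : ∀ j, DifferentiableAt ℝ (F j) 0 := fun j => by
    obtain ⟨d, hd, -⟩ := exists_hasDerivAt_thetaSeries hc j (t := 0) (by norm_num)
    exact hd.differentiableAt
  have hF1 : F 1 0 = 0 := thetaSeries_succ_zero c 0
  have hF2 : F 2 0 = 0 := thetaSeries_succ_zero c 1
  have hα00 : α 0 = 0 := by simp [hα]
  have hβ00 : β 0 = 0 := by simp [hβ]
  have hγ00 : γ 0 = 0 := by simp [hγ]
  have hαd : DifferentiableAt ℝ α 0 := by
    simp only [hα]; fun_prop (disch := norm_num)
  have hβd : DifferentiableAt ℝ β 0 := by simp only [hβ]; fun_prop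
  have hγd : DifferentiableAt ℝ γ 0 := by
    simp only [hγ]; fun_prop (disch := norm_num)
  have hFα : ∀ j, DifferentiableAt ℝ (fun z => F j (α z)) 0 := fun j =>
    DifferentiableAt.comp (g := F j) 0 (by rw [hα00]; exact hF0 j) hαd
  have hFβ : ∀ j, DifferentiableAt ℝ (fun z => F j (β z)) 0 := fun j =>
    DifferentiableAt.comp (g := F j) 0 (by rw [hβ00]; exact hF0 j) hβd
  have hFγ : ∀ j, DifferentiableAt ℝ (fun z => F j (γ z)) 0 := fun j =>
    DifferentiableAt.comp (g := F j) 0 (by rw [hγ00]; exact hF0 j) hγd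
  have hα1 := hFα 1
  have hα2 := hFα 2
  have hα3 := hFα 0
  have hβ1 := hFβ 1
  have hβ2 := hFβ 2
  have hβ3 := hFβ 0
  have hγ1 := hFγ 1
  have hγ2 := hFγ 2
  have hγ3 := hFγ 0
  have key := eq_zero_of_theta_ode (δ := 1 / 100) (z := z)
    (Y₀ := fun z => 1 * F 0 (α z) - 1 / 2 * ((1 + z) * F 0 (β z) + 1 / (1 + z) * F 0 (γ z)))
    (Y₁ := fun z => (0 * F 0 (α z) + 1 * ((2 + z) / (1 + z)) * F 1 (α z)) -
      1 / 2 * ((z * F 0 (β z) + (1 + z) * ((1 + 2 * z) / (1 + z)) * F 1 (β z)) +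
        (-z / (1 + z) ^ 2 * F 0 (γ z) + 1 / (1 + z) * ((1 - z) / (1 + z)) * F 1 (γ z))))
    (Y₂ := fun z => (0 * F 0 (α z) + (2 * 0 * ((2 + z) / (1 + z)) + 1 * (-z / (1 + z) ^ 2)) *
        F 1 (α z) + 1 * ((2 + z) / (1 + z)) ^ 2 * F 2 (α z)) -
      1 / 2 * ((z * F 0 (β z) + (2 * z * ((1 + 2 * z) / (1 + z)) + (1 + z) * (z / (1 + z) ^ 2)) *
          F 1 (β z) + (1 + z) * ((1 + 2 * z) / (1 + z)) ^ 2 * F 2 (β z)) +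
        (-(z * (1 - z)) / (1 + z) ^ 3 * F 0 (γ z) +
          (2 * (-z / (1 + z) ^ 2) * ((1 - z) / (1 + z)) +
            1 / (1 + z) * (-(2 * z) / (1 + z) ^ 2)) * F 1 (γ z) +
          1 / (1 + z) * ((1 - z) / (1 + z)) ^ 2 * F 2 (γ z))))
    (m₀ := fun z => (2 * z ^ 2 + z ^ 3) / (1 + z) ^ 3)
    (m₁ := fun z => (z / 2 + 5 * z ^ 2 + 13 * z ^ 3 / 2 + 3 * z ^ 4) /
      ((1 + z) ^ 2 * (1 + z + z ^ 2)))
    (m₂ := fun z => (3 * z / 2 + 3 * z ^ 2) / (1 + z + z ^ 2))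
    (fun z h h1 => ((hA z h h1).1.sub
      (((hB z h h1).1.add (hC z h h1).1).const_mul (1 / 2))).congr_deriv (by ring))
    (fun z h h1 => ((hA z h h1).2.1.sub
      (((hB z h h1).2.1.add (hC z h h1).2.1).const_mul (1 / 2))).congr_deriv (by ring))
    (fun z h h1 => ((hA z h h1).2.2.sub
      (((hB z h h1).2.2.add (hC z h h1).2.2).const_mul (1 / 2))).congr_deriv ?_)
    (fun z h h1 => ?_) ?_ ?_ ?_ ?_ ?_ ?_ hz hz1
  · simpa only [one_mul] using key
  · have hodeα := thetaSeries_ode hc hrec (hα8 h h1).le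
    have hodeβ := thetaSeries_ode hc hrec (hβ8 h h1).le
    have hodeγ := thetaSeries_ode hc hrec (hγ8 h h1).le
    have hz1 := hne h
    have hz2 : 1 + z + z ^ 2 ≠ 0 := by positivity
    rw [← hFdef] at hodeα hodeβ hodeγ
    generalize 64 * c 1 - 4 * c 0 = C at hodeα hodeβ hodeγ
    generalize F 0 (α z) = a0, F 1 (α z) = a1, F 2 (α z) = a2, F 3 (α z) = a3 at *
    generalize F 0 (β z) = b0, F 1 (β z) = b1, F 2 (β z) = b2, F 3 (β z) = b3 at *
    generalize F 0 (γ z) = c0, F 1 (γ z) = c1, F 2 (γ z) = c2, F 3 (γ z) = c3 at *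
    simp only [hα, hβ, hγ] at hodeα hodeβ hodeγ
    linear_combination (norm := skip)
      (2 + z) / (16 * (1 + z) * (1 + z + z ^ 2)) / z * hodeα -
      1 / 2 * ((1 + 2 * z) / (64 * (1 + z) ^ 2 * (1 + z + z ^ 2)) / z * hodeβ +
        (1 - z) / (64 * (1 + z + z ^ 2)) / z * hodeγ)
    field_simp
    ring
  · have : z ^ 2 < 1 / 100 * z := by nlinarith
    have h2 : 0 < z ^ 2 := by positivity
    have h3 : 0 < z ^ 3 := by positivity
    have h4 : 0 < z ^ 4 := by positivity
    have h5 : z ^ 3 < 1 / 100 * z ^ 2 := by nlinarith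
    have h6 : z ^ 4 < 1 / 100 * z ^ 3 := by nlinarith
    refine ⟨?_, ?_, ?_⟩
    · rw [abs_of_nonneg (by positivity), div_le_iff₀ (by positivity)]
      nlinarith
    · rw [abs_of_nonneg (by positivity), div_le_iff₀ (by positivity)]
      nlinarith
    · rw [abs_of_nonneg (by positivity), div_le_iff₀ (by positivity)]
      nlinarith
  iterate 3
    · obtain ⟨A, hA⟩ : ∃ A : ℕ → ℝ → ℝ, ∀ j z, F j (α z) = A j z := ⟨_, fun _ _ => rfl⟩
      obtain ⟨B, hB⟩ : ∃ B : ℕ → ℝ → ℝ, ∀ j z, F j (β z) = B j z := ⟨_, fun _ _ => rfl⟩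
      obtain ⟨C, hC⟩ : ∃ C : ℕ → ℝ → ℝ, ∀ j z, F j (γ z) = C j z := ⟨_, fun _ _ => rfl⟩
      simp only [hA, hB, hC] at hα1 hα2 hα3 hβ1 hβ2 hβ3 hγ1 hγ2 hγ3 ⊢
      fun_prop (disch := norm_num)
  · simp only [hα00, hβ00, hγ00]
    ring
  · simp [hα00, hβ00, hγ00, hF1]
  · simp [hα00, hβ00, hγ00, hF1, hF2]

theorem integrable_inv_add_pow {m : Measure ℝ} (hm : ∀ᵐ e ∂m, 0 < e)
    (hint : Integrable (fun e : ℝ => (e + 16)⁻¹) m) (n : ℕ) :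
    Integrable (fun e : ℝ => (e + 16)⁻¹ ^ (n + 1)) m ∧
      ∫ e, (e + 16)⁻¹ ^ (n + 1) ∂m ≤ (∫ e, (e + 16)⁻¹ ∂m) * (1 / 16) ^ n := by
  have hle : ∀ᵐ e ∂m, (e + 16)⁻¹ ^ (n + 1) ≤ (e + 16)⁻¹ * (1 / 16) ^ n := by
    filter_upwards [hm] with e he
    rw [pow_succ']
    gcongr
    rw [inv_eq_one_div]
    exact one_div_le_one_div_of_le (by norm_num) (by linarith)
  have h1 : Integrable (fun e : ℝ => (e + 16)⁻¹ ^ (n + 1)) m := by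
    refine (hint.mul_const ((1 / 16) ^ n)).mono' (by fun_prop) ?_
    filter_upwards [hm, hle] with e he h
    rwa [Real.norm_of_nonneg (by positivity)]
  refine ⟨h1, ?_⟩
  rw [← integral_mul_const]
  exact integral_mono_ae h1 (hint.mul_const _) hle

theorem thetaSeries_zero_eq_integral {m : Measure ℝ} (hm : ∀ᵐ e ∂m, 0 < e)
    (hint : Integrable (fun e : ℝ => (e + 16)⁻¹) m) {t : ℝ} (ht : |t| ≤ 8) :
    thetaSeries (fun n => ∫ e, (e + 16)⁻¹ ^ (n + 1) ∂m) 0 t = ∫ e, (e + 16 - t)⁻¹ ∂m := by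
  have hI := fun n => (integrable_inv_add_pow hm hint n).1
  have hB := fun n => (integrable_inv_add_pow hm hint n).2
  have hnn : ∀ n, 0 ≤ ∫ e, (e + 16)⁻¹ ^ (n + 1) ∂m := fun n =>
    integral_nonneg_of_ae (hm.mono fun e he => by simp only [Pi.zero_apply]; positivity)
  have hsum := hasSum_thetaSeries (c := fun n => ∫ e, (e + 16)⁻¹ ^ (n + 1) ∂m)
    (B := ∫ e, (e + 16)⁻¹ ∂m) (fun n => by rw [abs_of_nonneg (hnn n)]; exact hB n) 0
    (t := |t|) (by rwa [abs_abs])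
  have h := hasSum_integral_of_summable_integral_norm
    (F := fun (n : ℕ) (e : ℝ) => (e + 16)⁻¹ ^ (n + 1) * t ^ n) (μ := m)
    (fun n => (hI n).mul_const _) (by
      refine hsum.summable.congr fun n => ?_
      rw [pow_zero, one_mul, ← integral_mul_const]
      refine integral_congr_ae (hm.mono fun e he => ?_)
      simp only [norm_mul, norm_pow, Real.norm_eq_abs]
      rw [abs_of_pos (show 0 < (e + 16)⁻¹ by positivity)])
  rw [thetaSeries]
  simp only [pow_zero, one_mul, ← integral_mul_const]
  rw [h.tsum_eq]
  refine integral_congr_ae (hm.mono fun e he => ?_)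
  simp only
  have hgeo : HasSum (fun n : ℕ => (t / (e + 16)) ^ n) (1 - t / (e + 16))⁻¹ := by
    refine hasSum_geometric_of_norm_lt_one ?_
    rw [norm_div, Real.norm_eq_abs, Real.norm_eq_abs, abs_of_pos (by positivity : 0 < e + 16),
      div_lt_one (by positivity)]
    linarith
  have h2 := (hgeo.mul_left (e + 16)⁻¹).tsum_eq
  have h3 : (e + 16)⁻¹ * (1 - t / (e + 16))⁻¹ = (e + 16 - t)⁻¹ := by
    rw [← mul_inv]
    congr 1
    field_simp
  rw [← h3, ← h2]
  refine tsum_congr fun n => ?_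
  rw [pow_succ', div_eq_inv_mul, mul_pow]
  ring

/-- The linear relations follow from the recurrence satisfied by the moments of `(e + 16)⁻¹`. -/
theorem integral_inv_add_relations_of_recurrence {m : Measure ℝ} (hm : ∀ᵐ e ∂m, 0 < e)
    (hint : Integrable (fun e : ℝ => (e + 16)⁻¹) m)
    (hrec : ∀ n : ℕ, 64 * ((n : ℝ) + 2) ^ 3 * ∫ e, (e + 16)⁻¹ ^ (n + 2 + 1) ∂m -
      2 * (2 * n + 3) * (5 * ((n : ℝ) + 1) ^ 2 + 5 * (n + 1) + 2) *
        ∫ e, (e + 16)⁻¹ ^ (n + 1 + 1) ∂m +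
      ((n : ℝ) + 1) ^ 3 * ∫ e, (e + 16)⁻¹ ^ (n + 1) ∂m = 0) :
    Integrable (fun e : ℝ => e⁻¹) m ∧
    ∫ e, e⁻¹ ∂m = 2 * ∫ e, (e + 12)⁻¹ ∂m ∧
    ∫ e, (e + 18)⁻¹ ∂m = ∫ e, (e + 48)⁻¹ ∂m + 1 / 4 * ∫ e, (e + 12)⁻¹ ∂m := by
  refine integral_inv_add_relations hm hint (δ := 1 / 20000) (by norm_num) fun s hs1 hs2 => ?_
  obtain ⟨z, hz, hz1, hs⟩ : ∃ z : ℝ, 0 < z ∧ z < 1 / 100 ∧ s = 1 + z ^ 2 / (1 + z) := by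
    have hu : 0 < s - 1 := by linarith
    have hsq := Real.sq_sqrt (show 0 ≤ (s - 1) ^ 2 + 4 * (s - 1) by positivity)
    have hsq0 := Real.sqrt_nonneg ((s - 1) ^ 2 + 4 * (s - 1))
    have hz0 : 0 < (s - 1 + √((s - 1) ^ 2 + 4 * (s - 1))) / 2 := by positivity
    have heq : ((s - 1 + √((s - 1) ^ 2 + 4 * (s - 1))) / 2) ^ 2 =
        (s - 1) * (1 + (s - 1 + √((s - 1) ^ 2 + 4 * (s - 1))) / 2) := by
      linear_combination 1 / 4 * hsq
    refine ⟨_, hz0, ?_, ?_⟩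
    · by_contra! hcon
      nlinarith
    · rw [heq]
      field_simp
      ring
  have hw : 0 < 1 + z := by linarith
  have h8α : |-4 * z ^ 2 / (1 + z)| ≤ 8 := by
    rw [abs_le, le_div_iff₀ hw, div_le_iff₀ hw]
    constructor <;> nlinarith
  have h8β : |-16 * z * (1 + z)| ≤ 8 := by
    rw [abs_le]
    constructor <;> nlinarith
  have h8γ : |16 * z / (1 + z) ^ 2| ≤ 8 := by
    rw [abs_le, le_div_iff₀ (by positivity), div_le_iff₀ (by positivity)]
    constructor <;> nlinarith
  have hfun := thetaSeries_functional_equation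
    (c := fun n => ∫ e, (e + 16)⁻¹ ^ (n + 1) ∂m) (B := ∫ e, (e + 16)⁻¹ ∂m) (fun n => by
      rw [abs_of_nonneg (integral_nonneg_of_ae
        (hm.mono fun e he => by simp only [Pi.zero_apply]; positivity))]
      exact (integrable_inv_add_pow hm hint n).2) hrec hz hz1
  rw [thetaSeries_zero_eq_integral hm hint h8α, thetaSeries_zero_eq_integral hm hint h8β,
    thetaSeries_zero_eq_integral hm hint h8γ] at hfun
  have hint' : ∀ {t : ℝ}, |t| ≤ 8 → Integrable (fun e : ℝ => (e + 16 - t)⁻¹) m := fun {t} ht => by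
    have := integrable_inv_add (hm.mono fun e he => he.le) hint
      (show 0 < 16 - t by linarith [(abs_le.1 ht).2])
    simpa only [add_sub_assoc] using this
  have hzero : ∫ e, ((e + 16 - -4 * z ^ 2 / (1 + z))⁻¹ - 1 / 2 * ((1 + z) *
      (e + 16 - -16 * z * (1 + z))⁻¹ + 1 / (1 + z) * (e + 16 - 16 * z / (1 + z) ^ 2)⁻¹)) ∂m =
      0 := by
    have hsum : Integrable (fun e : ℝ => (1 + z) * (e + 16 - -16 * z * (1 + z))⁻¹ +
        1 / (1 + z) * (e + 16 - 16 * z / (1 + z) ^ 2)⁻¹) m :=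
      ((hint' h8β).const_mul _).add ((hint' h8γ).const_mul _)
    rw [integral_sub (hint' h8α) (hsum.const_mul _), integral_const_mul,
      integral_add ((hint' h8β).const_mul _) ((hint' h8γ).const_mul _),
      integral_const_mul, integral_const_mul]
    exact hfun
  refine Eq.trans ?_ hzero
  refine integral_congr_ae (hm.mono fun e he => ?_)
  have h1 : e + 16 - -4 * z ^ 2 / (1 + z) ≠ 0 := by
    have : 0 ≤ 4 * z ^ 2 / (1 + z) := by positivity
    have h : -4 * z ^ 2 / (1 + z) = -(4 * z ^ 2 / (1 + z)) := by ring
    rw [h]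
    linarith
  have h2 : e + 16 - -16 * z * (1 + z) ≠ 0 := by nlinarith
  have h3 : e + 16 - 16 * z / (1 + z) ^ 2 ≠ 0 := by
    have := (abs_le.1 h8γ).2
    linarith
  have hQ : e ^ 2 + 16 * s * (1 + s) * e + 256 * s ^ 2 =
      (e + 16 - -16 * z * (1 + z)) * (e + 16 - 16 * z / (1 + z) ^ 2) := by
    rw [hs]; field_simp; ring
  have hL : e + 12 + 4 * s = e + 16 - -4 * z ^ 2 / (1 + z) := by
    rw [hs]; field_simp; ring
  have hP : e * (1 + s) / 2 + 16 * s = 1 / 2 * ((1 + z) * (e + 16 - 16 * z / (1 + z) ^ 2) +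
      1 / (1 + z) * (e + 16 - -16 * z * (1 + z))) := by
    rw [hs]; field_simp; ring
  simp only
  rw [hQ, hL, hP]
  generalize e + 16 - -4 * z ^ 2 / (1 + z) = a at *
  generalize e + 16 - -16 * z * (1 + z) = b at *
  generalize e + 16 - 16 * z / (1 + z) ^ 2 = d at *
  field_simp

/-- The integrals `∫₀^∞ exp (-y - w / y) y⁻ᵏ dy`; up to elementary factors they are modified Bessel
functions of the second kind. -/
noncomputable def besselIntegral (k : ℕ) (w : ℝ) : ℝ :=
  ∫ y in Set.Ioi (0 : ℝ), Real.exp (-y - w / y) * y⁻¹ ^ k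

theorem exp_neg_div_mul_inv_pow_le (k : ℕ) {a w y : ℝ} (ha : 0 < a) (haw : a ≤ w) (hy : 0 < y) :
    Real.exp (-y - w / y) * y⁻¹ ^ k ≤ k.factorial / a ^ k * Real.exp (-y) := by
  have h1 := Real.pow_div_factorial_le_exp (a / y) (by positivity) k
  have h2 : Real.exp (-y - w / y) ≤ Real.exp (-y) * (Real.exp (a / y))⁻¹ := by
    rw [← Real.exp_neg, ← Real.exp_add]
    gcongr
    have : a / y ≤ w / y := by gcongr
    linarith
  have h3 : y⁻¹ ^ k ≤ k.factorial / a ^ k * Real.exp (a / y) := by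
    calc y⁻¹ ^ k = k.factorial / a ^ k * ((a / y) ^ k / k.factorial) := by
          have := Nat.factorial_pos k
          rw [div_pow, inv_pow]
          field_simp
      _ ≤ _ := by gcongr
  calc Real.exp (-y - w / y) * y⁻¹ ^ k
      ≤ Real.exp (-y) * (Real.exp (a / y))⁻¹ * (k.factorial / a ^ k * Real.exp (a / y)) := by
        gcongr
    _ = k.factorial / a ^ k * Real.exp (-y) := by
        have := Real.exp_pos (a / y)
        field_simp

theorem measurable_exp_neg_div_mul_inv_pow (k : ℕ) (w : ℝ) :
    Measurable fun y : ℝ => Real.exp (-y - w / y) * y⁻¹ ^ k := by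
  fun_prop

theorem integrableOn_exp_neg_div_mul_inv_pow (k : ℕ) {w : ℝ} (hw : 0 < w) :
    IntegrableOn (fun y : ℝ => Real.exp (-y - w / y) * y⁻¹ ^ k) (Set.Ioi 0) := by
  refine ((integrableOn_exp_neg_Ioi 0).const_mul (k.factorial / w ^ k)).mono'
    (measurable_exp_neg_div_mul_inv_pow k w).aestronglyMeasurable ?_
  refine (ae_restrict_iff' measurableSet_Ioi).2 (.of_forall fun y (hy : 0 < y) => ?_)
  rw [Real.norm_of_nonneg (by positivity)]
  exact exp_neg_div_mul_inv_pow_le k hw le_rfl hy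

theorem hasDerivAt_besselIntegral (k : ℕ) {w : ℝ} (hw : 0 < w) :
    HasDerivAt (besselIntegral k) (-besselIntegral (k + 1) w) w := by
  have h := (hasDerivAt_integral_of_dominated_loc_of_deriv_le
    (μ := volume.restrict (Set.Ioi (0 : ℝ))) (x₀ := w) (s := Set.Ioi (w / 2))
    (F := fun w y => Real.exp (-y - w / y) * y⁻¹ ^ k)
    (F' := fun w y => -(Real.exp (-y - w / y) * y⁻¹ ^ (k + 1)))
    (bound := fun y => (k + 1).factorial / (w / 2) ^ (k + 1) * Real.exp (-y))
    (Ioi_mem_nhds (by linarith))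
    (.of_forall fun v => (measurable_exp_neg_div_mul_inv_pow k v).aestronglyMeasurable)
    (integrableOn_exp_neg_div_mul_inv_pow k hw)
    (measurable_exp_neg_div_mul_inv_pow (k + 1) w).neg.aestronglyMeasurable ?_
    ((integrableOn_exp_neg_Ioi 0).const_mul _) ?_).2
  · rwa [integral_neg] at h
  · refine (ae_restrict_iff' measurableSet_Ioi).2 (.of_forall fun y (hy : 0 < y) v hv => ?_)
    rw [norm_neg, Real.norm_of_nonneg (by positivity)]
    exact exp_neg_div_mul_inv_pow_le (k + 1) (by linarith) (le_of_lt hv) hy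
  · refine (ae_restrict_iff' measurableSet_Ioi).2 (.of_forall fun y (hy : 0 < y) v _ => ?_)
    have h1 : HasDerivAt (fun v : ℝ => -y - v / y) (-(1 / y)) v :=
      ((hasDerivAt_id' v).div_const y).const_sub (-y)
    refine (h1.exp.mul_const _).congr_deriv ?_
    rw [pow_succ, one_div]
    ring

theorem besselIntegral_two {w : ℝ} (hw : 0 < w) :
    besselIntegral 2 w = besselIntegral 0 w / w := by
  have h0 := integrableOn_exp_neg_div_mul_inv_pow 0 hw
  have h2 := (integrableOn_exp_neg_div_mul_inv_pow 2 hw).const_mul w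
  have hd : ∀ y ∈ Set.Ioi (0 : ℝ), HasDerivAt (fun y : ℝ => Real.exp (-y - w / y))
      (w * (Real.exp (-y - w / y) * y⁻¹ ^ 2) - Real.exp (-y - w / y) * y⁻¹ ^ 0) y := by
    intro y hy
    have hy' : y ≠ 0 := ne_of_gt hy
    have h1 : HasDerivAt (fun y : ℝ => -y - w * y⁻¹) (-1 - w * -(y ^ 2)⁻¹) y :=
      (hasDerivAt_neg y).sub ((hasDerivAt_inv hy').const_mul w)
    simp only [div_eq_mul_inv]
    refine h1.exp.congr_deriv ?_
    rw [inv_pow]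
    ring
  have hle : ∀ y ∈ Set.Ioi (0 : ℝ), Real.exp (-y - w / y) ≤ y / w * Real.exp (-y) := by
    intro y (hy : 0 < y)
    have := exp_neg_div_mul_inv_pow_le 1 hw le_rfl hy
    rw [pow_one, ← div_eq_mul_inv, div_le_iff₀ hy] at this
    refine this.trans_eq ?_
    simp
    ring
  have hlim0 : Filter.Tendsto (fun y : ℝ => Real.exp (-y - w / y)) (nhdsWithin 0 (Set.Ioi 0))
      (nhds 0) := by
    refine squeeze_zero' (.of_forall fun y => (Real.exp_pos _).le)
      (eventually_nhdsWithin_of_forall hle) ?_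
    have : ContinuousAt (fun y : ℝ => y / w * Real.exp (-y)) 0 := by fun_prop
    simpa using this.continuousWithinAt.tendsto
  have hlim1 : Filter.Tendsto (fun y : ℝ => Real.exp (-y - w / y)) Filter.atTop (nhds 0) := by
    refine squeeze_zero' (.of_forall fun y => (Real.exp_pos _).le)
      ((Filter.eventually_gt_atTop 0).mono fun y hy => Real.exp_le_exp.2 ?_)
      Real.tendsto_exp_neg_atTop_nhds_zero
    have : 0 ≤ w / y := by positivity
    linarith
  have h := integral_Ioi_deriv_mul_eq_sub (a := 0) (a' := 0) (b' := 0)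
    (u := fun y : ℝ => Real.exp (-y - w / y))
    (v := fun _ => 1) (v' := fun _ => 0) hd (fun y _ => hasDerivAt_const y 1)
    ((h2.sub h0).congr (.of_forall fun y => by simp))
    (hlim0.congr fun y => by simp) (hlim1.congr fun y => by simp)
  simp only [mul_one, mul_zero, add_zero, sub_zero] at h
  rw [integral_sub h2 h0, integral_const_mul] at h
  rw [besselIntegral, besselIntegral, eq_div_iff hw.ne']
  linarith

/-- Continuous functions on `(0, ∞)` which are `O(w⁻ᵃ)` for every `a > 0`. -/
def IsRapid (P : ℝ → ℝ) : Prop :=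
  ContinuousOn P (Set.Ioi 0) ∧ ∀ a : ℝ, 0 < a → ∃ C : ℝ, ∀ w : ℝ, 0 < w → |P w| ≤ C * w ^ (-a)

theorem IsRapid.mul {P R : ℝ → ℝ} (hP : IsRapid P) (hR : IsRapid R) :
    IsRapid fun w => P w * R w := by
  refine ⟨hP.1.mul hR.1, fun a ha => ?_⟩
  obtain ⟨C, hC⟩ := hP.2 (a / 2) (by positivity)
  obtain ⟨D, hD⟩ := hR.2 (a / 2) (by positivity)
  refine ⟨C * D, fun w hw => ?_⟩
  rw [abs_mul, show -a = -(a / 2) + -(a / 2) by ring, Real.rpow_add hw]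
  calc |P w| * |R w| ≤ (C * w ^ (-(a / 2))) * (D * w ^ (-(a / 2))) :=
        mul_le_mul (hC w hw) (hD w hw) (abs_nonneg _) ((abs_nonneg _).trans (hC w hw))
    _ = _ := by ring

theorem IsRapid.integrableOn {P : ℝ → ℝ} (hP : IsRapid P) (n : ℕ) :
    IntegrableOn (fun w => w ^ n * P w) (Set.Ioi 0) := by
  have hcont : ContinuousOn (fun w => w ^ n * P w) (Set.Ioi 0) :=
    (continuous_pow n).continuousOn.mul hP.1
  rw [← Set.Ioc_union_Ioi_eq_Ioi (zero_le_one' ℝ), integrableOn_union]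
  constructor
  · obtain ⟨C, hC⟩ := hP.2 (1 / 2) (by norm_num)
    have hint : IntegrableOn (fun w : ℝ => C * w ^ (-(1 / 2) : ℝ)) (Set.Ioc 0 1) :=
      ((intervalIntegrable_iff_integrableOn_Ioc_of_le zero_le_one).1
        (intervalIntegral.intervalIntegrable_rpow' (by norm_num))).const_mul C
    refine hint.mono' ((hcont.mono Set.Ioc_subset_Ioi_self).aestronglyMeasurable
      measurableSet_Ioc) ?_
    refine (ae_restrict_iff' measurableSet_Ioc).2 (.of_forall fun w hw => ?_)
    rw [norm_mul, Real.norm_eq_abs, Real.norm_eq_abs, abs_of_nonneg (pow_nonneg hw.1.le n)]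
    exact (mul_le_of_le_one_left (abs_nonneg _) (pow_le_one₀ hw.1.le hw.2)).trans (hC w hw.1)
  · obtain ⟨C, hC⟩ := hP.2 (n + 2) (by positivity)
    have hint : IntegrableOn (fun w : ℝ => C * w ^ (-2 : ℝ)) (Set.Ioi 1) :=
      (integrableOn_Ioi_rpow_of_lt (by norm_num) one_pos).const_mul C
    refine hint.mono' ((hcont.mono (Set.Ioi_subset_Ioi zero_le_one)).aestronglyMeasurable
      measurableSet_Ioi) ?_
    refine (ae_restrict_iff' measurableSet_Ioi).2 (.of_forall fun w (hw : 1 < w) => ?_)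
    have hw0 : 0 < w := by linarith
    rw [norm_mul, Real.norm_eq_abs, Real.norm_eq_abs, abs_of_nonneg (by positivity)]
    calc w ^ n * |P w| ≤ w ^ n * (C * w ^ (-((n : ℝ) + 2))) := by gcongr; exact hC w hw0
      _ = C * (w ^ (n : ℝ) * w ^ (-((n : ℝ) + 2))) := by rw [Real.rpow_natCast]; ring
      _ = C * w ^ (-2 : ℝ) := by rw [← Real.rpow_add hw0]; ring_nf

theorem IsRapid.tendsto_zero {P : ℝ → ℝ} (hP : IsRapid P) (n : ℕ) :
    Filter.Tendsto (fun w => w ^ (n + 1) * P w) (nhdsWithin 0 (Set.Ioi 0)) (nhds 0) := by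
  obtain ⟨C, hC⟩ := hP.2 (1 / 2) (by norm_num)
  refine squeeze_zero_norm' (a := fun w : ℝ => w ^ n * (C * w ^ (1 / 2 : ℝ))) ?_ ?_
  · refine eventually_nhdsWithin_of_forall fun w (hw : 0 < w) => ?_
    rw [norm_mul, Real.norm_eq_abs, Real.norm_eq_abs, abs_of_nonneg (by positivity), pow_succ,
      mul_assoc]
    refine mul_le_mul_of_nonneg_left ?_ (by positivity)
    calc w * |P w| ≤ w * (C * w ^ (-(1 / 2) : ℝ)) := by gcongr; exact hC w hw
      _ = C * (w ^ (1 : ℝ) * w ^ (-(1 / 2) : ℝ)) := by rw [Real.rpow_one]; ring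
      _ = C * w ^ (1 / 2 : ℝ) := by rw [← Real.rpow_add hw]; norm_num
  · have h : ContinuousAt (fun w : ℝ => w ^ n * (C * w ^ (1 / 2 : ℝ))) 0 :=
      (continuous_pow n).continuousAt.mul
        (continuousAt_const.mul (Real.continuousAt_rpow_const _ _ (Or.inr (by norm_num))))
    simpa using h.continuousWithinAt.tendsto

theorem IsRapid.tendsto_atTop {P : ℝ → ℝ} (hP : IsRapid P) (n : ℕ) :
    Filter.Tendsto (fun w => w ^ n * P w) Filter.atTop (nhds 0) := by
  obtain ⟨C, hC⟩ := hP.2 (n + 1) (by positivity)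
  refine squeeze_zero_norm' (a := fun w : ℝ => C * w⁻¹) ?_ ?_
  · filter_upwards [Filter.eventually_gt_atTop 0] with w hw
    rw [norm_mul, Real.norm_eq_abs, Real.norm_eq_abs, abs_of_nonneg (by positivity)]
    calc w ^ n * |P w| ≤ w ^ n * (C * w ^ (-((n : ℝ) + 1))) := by gcongr; exact hC w hw
      _ = C * (w ^ (n : ℝ) * w ^ (-((n : ℝ) + 1))) := by rw [Real.rpow_natCast]; ring
      _ = C * w⁻¹ := by rw [← Real.rpow_add hw, ← Real.rpow_neg_one]; ring_nf
  · simpa using tendsto_inv_atTop_zero.const_mul C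

theorem IsRapid.integral_pow_mul {P S T : ℝ → ℝ} {s t : ℝ} (hP : IsRapid P) (hS : IsRapid S)
    (hT : IsRapid T) (hd : ∀ w, 0 < w → HasDerivAt P (-(s * S w / w + t * T w)) w) (n : ℕ) :
    ((n : ℝ) + 1) * ∫ w in Set.Ioi (0 : ℝ), w ^ n * P w =
      s * (∫ w in Set.Ioi (0 : ℝ), w ^ n * S w) +
        t * ∫ w in Set.Ioi (0 : ℝ), w ^ (n + 1) * T w := by
  have heq : Set.EqOn (fun w : ℝ => ((n : ℝ) + 1) * (w ^ n * P w) -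
      (s * (w ^ n * S w) + t * (w ^ (n + 1) * T w))) (fun w => ((n : ℝ) + 1) * w ^ n * P w +
        w ^ (n + 1) * -(s * S w / w + t * T w)) (Set.Ioi 0) := by
    intro w hw
    have hw' : w ≠ 0 := ne_of_gt hw
    simp only
    field_simp
    ring
  have hIP := (hP.integrableOn n).const_mul ((n : ℝ) + 1)
  have hIS := (hS.integrableOn n).const_mul s
  have hIT := (hT.integrableOn (n + 1)).const_mul t
  have hI : IntegrableOn (fun w : ℝ => s * (w ^ n * S w) + t * (w ^ (n + 1) * T w))
      (Set.Ioi 0) := hIS.add hIT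
  have h := integral_Ioi_deriv_mul_eq_sub (a := 0) (u := fun w : ℝ => w ^ (n + 1))
    (u' := fun w => ((n : ℝ) + 1) * w ^ n) (v := P)
    (fun w _ => by simpa using hasDerivAt_pow (n + 1) w) (fun w hw => hd w hw)
    (IntegrableOn.congr_fun (hIP.sub hI) heq measurableSet_Ioi)
    (hP.tendsto_zero n) (hP.tendsto_atTop (n + 1))
  rw [← setIntegral_congr_fun measurableSet_Ioi heq, integral_sub hIP hI, integral_const_mul,
    integral_add hIS hIT, integral_const_mul, integral_const_mul] at h
  linarith

theorem isRapid_besselIntegral {k : ℕ} (hk : k ≤ 1) : IsRapid (besselIntegral k) := by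
  refine ⟨fun w hw => (hasDerivAt_besselIntegral k hw).continuousAt.continuousWithinAt,
    fun a ha => ?_⟩
  have hk' : (k : ℝ) ≤ 1 := by exact_mod_cast hk
  have hG := Real.GammaIntegral_convergent (s := a + 1 - k) (by linarith)
  refine ⟨a ^ a * ∫ y in Set.Ioi (0 : ℝ), Real.exp (-y) * y ^ (a + 1 - k - 1), fun w hw => ?_⟩
  have hnn : 0 ≤ besselIntegral k w := setIntegral_nonneg measurableSet_Ioi fun y (hy : 0 < y) => by
    positivity
  rw [abs_of_nonneg hnn, mul_right_comm, ← integral_const_mul]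
  refine setIntegral_mono_on (integrableOn_exp_neg_div_mul_inv_pow k hw) (hG.const_mul _)
    measurableSet_Ioi fun y (hy : 0 < y) => ?_
  have hle : Real.exp (-(w / y)) ≤ a ^ a * w ^ (-a) * y ^ a := by
    have h1 : w / y / a ≤ Real.exp (w / y / a) := by linarith [Real.add_one_le_exp (w / y / a)]
    have h2 : (w / y / a) ^ a ≤ Real.exp (w / y) := by
      refine (Real.rpow_le_rpow (by positivity) h1 ha.le).trans_eq ?_
      rw [← Real.exp_mul]
      congr 1
      field_simp
    rw [Real.exp_neg]
    refine (inv_anti₀ (by positivity) h2).trans_eq ?_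
    rw [Real.div_rpow (by positivity) ha.le, Real.div_rpow hw.le hy.le, Real.rpow_neg hw.le]
    field_simp
  have hpow : y ^ (a + 1 - k - 1) = y ^ a * y⁻¹ ^ k := by
    rw [show a + 1 - k - 1 = a - k by ring, Real.rpow_sub hy, Real.rpow_natCast, inv_pow,
      div_eq_mul_inv]
  rw [hpow, sub_eq_add_neg, Real.exp_add]
  calc Real.exp (-y) * Real.exp (-(w / y)) * y⁻¹ ^ k
      ≤ Real.exp (-y) * (a ^ a * w ^ (-a) * y ^ a) * y⁻¹ ^ k := by gcongr
    _ = _ := by ring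

theorem IsRapid.pow_succ {P : ℝ → ℝ} (hP : IsRapid P) (n : ℕ) :
    IsRapid fun w => P w ^ (n + 1) := by
  induction n with
  | zero => simpa using hP
  | succ n ih =>
    simp only [_root_.pow_succ _ (n + 1)]
    exact ih.mul hP

/-- The moments of the fourth power of `besselIntegral 1`. -/
noncomputable def besselMoment (n : ℕ) : ℝ :=
  ∫ w in Set.Ioi (0 : ℝ), w ^ n * besselIntegral 1 w ^ 4

theorem integrableOn_pow_mul_besselIntegral (n : ℕ) :
    IntegrableOn (fun w => w ^ n * besselIntegral 1 w ^ 4) (Set.Ioi 0) :=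
  ((isRapid_besselIntegral le_rfl).pow_succ 3).integrableOn n

theorem besselMoment_recurrence (n : ℕ) :
    64 * ((n : ℝ) + 2) * besselMoment (n + 2) -
      2 * (2 * n + 3) * (5 * ((n : ℝ) + 1) ^ 2 + 5 * (n + 1) + 2) * besselMoment (n + 1) +
      ((n : ℝ) + 1) ^ 5 * besselMoment n = 0 := by
  set K := besselIntegral 1 with hKdef
  set Q := besselIntegral 0 with hQdef
  have hK : IsRapid K := isRapid_besselIntegral le_rfl
  have hQ : IsRapid Q := isRapid_besselIntegral zero_le_one
  have hdK : ∀ {w : ℝ}, 0 < w → HasDerivAt K (-(Q w / w)) w := fun {w} hw => by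
    rw [hQdef, ← besselIntegral_two hw]
    exact hasDerivAt_besselIntegral 1 hw
  have hdQ : ∀ {w : ℝ}, 0 < w → HasDerivAt Q (-K w) w := fun {w} hw =>
    hasDerivAt_besselIntegral 0 hw
  have h0 : IsRapid fun w => K w ^ 4 := hK.pow_succ 3
  have h1 : IsRapid fun w => K w ^ 3 * Q w := (hK.pow_succ 2).mul hQ
  have h2 : IsRapid fun w => K w ^ 2 * Q w ^ 2 := (hK.pow_succ 1).mul (hQ.pow_succ 1)
  have h3 : IsRapid fun w => K w * Q w ^ 3 := hK.mul (hQ.pow_succ 2)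
  have h4 : IsRapid fun w => Q w ^ 4 := hQ.pow_succ 3
  have e0 := h0.integral_pow_mul (s := 4) (t := 0) h1 h0 fun w hw => by
    refine ((hdK hw).pow 4).congr_deriv ?_
    push_cast
    ring
  have e1 := h1.integral_pow_mul (s := 3) (t := 1) h2 h0 fun w hw => by
    refine (((hdK hw).pow 3).mul (hdQ hw)).congr_deriv ?_
    simp only [Pi.pow_apply]
    push_cast
    ring
  have e2 := h2.integral_pow_mul (s := 2) (t := 2) h3 h1 fun w hw => by
    refine (((hdK hw).pow 2).mul ((hdQ hw).pow 2)).congr_deriv ?_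
    simp only [Pi.pow_apply]
    push_cast
    ring
  have e3 := h3.integral_pow_mul (s := 1) (t := 3) h4 h2 fun w hw => by
    refine ((hdK hw).mul ((hdQ hw).pow 3)).congr_deriv ?_
    simp only [Pi.pow_apply]
    push_cast
    ring
  have e4 := h4.integral_pow_mul (s := 0) (t := 4) h0 h3 fun w hw => by
    refine ((hdQ hw).pow 4).congr_deriv ?_
    push_cast
    ring
  have a0 := e0 n
  have a1 := e1 n
  have a2 := e2 n
  have a3 := e3 n
  have a4 := e4 n
  have b0 := e0 (n + 1)
  have b1 := e1 (n + 1)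
  have b2 := e2 (n + 1)
  have d0 := e0 (n + 1 + 1)
  push_cast at a0 a1 a2 a3 a4 b0 b1 b2 d0
  simp only [besselMoment]
  linear_combination ((n : ℝ) + 1) ^ 4 * a0 + 4 * ((n : ℝ) + 1) ^ 3 * a1 +
    12 * ((n : ℝ) + 1) ^ 2 * a2 + 24 * ((n : ℝ) + 1) * a3 + 24 * a4 -
    48 * b2 - (40 * ((n : ℝ) + 1) + 16) * b1 -
    (6 * ((n : ℝ) + 1) ^ 2 + (10 * ((n : ℝ) + 1) + 4) * (n + 2)) * b0 + 24 * d0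

/-- The multiplicative Haar measure `dx / x` on `(0, ∞)`, as a measure on `ℝ`. -/
noncomputable def mulHaar : Measure ℝ :=
  (volume.restrict (Set.Ioi 0)).withDensity fun x => ENNReal.ofReal x⁻¹

instance : SigmaFinite mulHaar :=
  inferInstanceAs (SigmaFinite ((volume.restrict (Set.Ioi (0 : ℝ))).withDensity fun x =>
    ENNReal.ofReal x⁻¹))

theorem mulHaar_absolutelyContinuous : mulHaar ≪ volume.restrict (Set.Ioi 0) :=
  withDensity_absolutelyContinuous _ _

theorem ae_mulHaar_pos : ∀ᵐ x ∂mulHaar, 0 < x :=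
  mulHaar_absolutelyContinuous.ae_le (ae_restrict_mem measurableSet_Ioi)

theorem ae_mulHaar_ne (c : ℝ) : ∀ᵐ x ∂mulHaar, x ≠ c :=
  mulHaar_absolutelyContinuous.ae_le (ae_restrict_of_ae (Measure.ae_ne volume c))

theorem lintegral_mulHaar {f : ℝ → ENNReal} (hf : Measurable f) :
    ∫⁻ x, f x ∂mulHaar = ∫⁻ x in Set.Ioi 0, ENNReal.ofReal x⁻¹ * f x := by
  rw [mulHaar, lintegral_withDensity_eq_lintegral_mul _ (by fun_prop) hf]
  rfl

theorem integral_mulHaar (f : ℝ → ℝ) :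
    ∫ x, f x ∂mulHaar = ∫ x in Set.Ioi 0, x⁻¹ * f x := by
  rw [mulHaar, integral_withDensity_eq_integral_toReal_smul (by fun_prop) (by simp)]
  refine setIntegral_congr_fun measurableSet_Ioi fun x (hx : 0 < x) => ?_
  simp only [smul_eq_mul]
  rw [ENNReal.toReal_ofReal (by positivity)]

theorem lintegral_mulHaar_comp_mul_left {f : ℝ → ENNReal} (hf : Measurable f) {c : ℝ}
    (hc : 0 < c) : ∫⁻ x, f (c * x) ∂mulHaar = ∫⁻ x, f x ∂mulHaar := by
  rw [lintegral_mulHaar hf, lintegral_mulHaar (by fun_prop)]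
  have h := lintegral_image_eq_lintegral_abs_deriv_mul (s := Set.Ioi (0 : ℝ)) (f := (c * ·))
    (f' := fun _ => c) measurableSet_Ioi
    (fun x _ => by simpa using ((hasDerivAt_id x).const_mul c).hasDerivWithinAt)
    (mul_right_injective₀ hc.ne').injOn (fun x => ENNReal.ofReal x⁻¹ * f x)
  rw [Set.image_mul_left_Ioi hc, mul_zero] at h
  rw [h]
  refine setLIntegral_congr_fun measurableSet_Ioi fun x (hx : 0 < x) => ?_
  rw [← mul_assoc, ← ENNReal.ofReal_mul (by positivity), abs_of_pos hc, mul_inv]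
  congr 2
  field_simp

theorem lintegral_mulHaar_ofReal {f : ℝ → ℝ} (hf : Measurable f)
    (hint : IntegrableOn (fun x => x⁻¹ * f x) (Set.Ioi 0)) (hnn : ∀ x, 0 < x → 0 ≤ f x) :
    ∫⁻ x, ENNReal.ofReal (f x) ∂mulHaar = ENNReal.ofReal (∫ x in Set.Ioi 0, x⁻¹ * f x) := by
  rw [lintegral_mulHaar (by fun_prop), ofReal_integral_eq_lintegral_ofReal hint]
  · refine setLIntegral_congr_fun measurableSet_Ioi fun x (hx : 0 < x) => ?_
    rw [ENNReal.ofReal_mul (by positivity)]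
  · refine (ae_restrict_iff' measurableSet_Ioi).2 (.of_forall fun x (hx : 0 < x) => ?_)
    exact mul_nonneg (by positivity) (hnn x hx)

theorem lintegral_mulHaar_pow_mul_exp (n : ℕ) {A : ℝ} (hA : 0 < A) :
    ∫⁻ x, ENNReal.ofReal (x ^ (n + 1) * Real.exp (-(A * x))) ∂mulHaar =
      ENNReal.ofReal (n.factorial * A⁻¹ ^ (n + 1)) := by
  have hG : ∀ y ∈ Set.Ioi (0 : ℝ), Real.exp (-y) * y ^ ((n : ℝ) + 1 - 1) =
      y⁻¹ * (y ^ (n + 1) * Real.exp (-y)) := by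
    intro y (hy : 0 < y)
    rw [add_sub_cancel_right, Real.rpow_natCast]
    field_simp
    ring
  have h := lintegral_mulHaar_ofReal (f := fun y => y ^ (n + 1) * Real.exp (-y)) (by fun_prop)
    ((Real.GammaIntegral_convergent (s := n + 1) (by positivity)).congr_fun hG measurableSet_Ioi)
    (fun y hy => by positivity)
  rw [← setIntegral_congr_fun measurableSet_Ioi hG, ← Real.Gamma_eq_integral (by positivity),
    Real.Gamma_nat_eq_factorial, ← lintegral_mulHaar_comp_mul_left (by fun_prop) hA] at h
  have hc : ∀ x : ℝ, ENNReal.ofReal (x ^ (n + 1) * Real.exp (-(A * x))) =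
      ENNReal.ofReal (A⁻¹ ^ (n + 1)) *
        ENNReal.ofReal ((A * x) ^ (n + 1) * Real.exp (-(A * x))) := by
    intro x
    rw [← ENNReal.ofReal_mul (by positivity)]
    congr 1
    rw [mul_pow, inv_pow]
    field_simp
  simp_rw [hc]
  rw [lintegral_const_mul _ (by fun_prop), h, ← ENNReal.ofReal_mul (by positivity), mul_comm]

theorem lintegral_mulHaar_exp_neg_div {w : ℝ} (hw : 0 < w) :
    ∫⁻ y, ENNReal.ofReal (Real.exp (-y - w / y)) ∂mulHaar =
      ENNReal.ofReal (besselIntegral 1 w) := by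
  have hK : ∀ y : ℝ, Real.exp (-y - w / y) * y⁻¹ ^ 1 = y⁻¹ * Real.exp (-y - w / y) := fun y => by
    ring
  have h := integrableOn_exp_neg_div_mul_inv_pow 1 hw
  simp_rw [hK] at h
  rw [lintegral_mulHaar_ofReal (by fun_prop) h fun y _ => by positivity, besselIntegral]
  simp_rw [hK]

theorem lintegral_mulHaar_besselIntegral (n : ℕ) :
    ∫⁻ w, ENNReal.ofReal (w ^ (n + 1)) * (∫⁻ y, ENNReal.ofReal (Real.exp (-y - w / y)) ∂mulHaar) ^ 4
      ∂mulHaar = ENNReal.ofReal (besselMoment n) := by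
  have hm : Measurable fun w : ℝ => ∫⁻ y, ENNReal.ofReal (Real.exp (-y - w / y)) ∂mulHaar :=
    Measurable.lintegral_prod_right' (f := fun p : ℝ × ℝ =>
      ENNReal.ofReal (Real.exp (-p.2 - p.1 / p.2))) (by fun_prop)
  rw [lintegral_mulHaar (by fun_prop), besselMoment,
    ofReal_integral_eq_lintegral_ofReal (integrableOn_pow_mul_besselIntegral n)]
  · refine setLIntegral_congr_fun measurableSet_Ioi fun w (hw : 0 < w) => ?_
    have hnn : 0 ≤ besselIntegral 1 w :=
      setIntegral_nonneg measurableSet_Ioi fun y (hy : 0 < y) => by positivity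
    rw [lintegral_mulHaar_exp_neg_div hw, ← ENNReal.ofReal_pow hnn,
      ← ENNReal.ofReal_mul (by positivity), ← ENNReal.ofReal_mul (by positivity)]
    congr 1
    field_simp
    ring
  · refine (ae_restrict_iff' measurableSet_Ioi).2 (.of_forall fun w (hw : 0 < w) => ?_)
    have : (0 : ℝ) ≤ w ^ n := by positivity
    exact mul_nonneg this ((show Even 4 by decide).pow_nonneg _)

/-- The Haar measure `dx₁ dx₂ dx₃ / (x₁ x₂ x₃)` on `(0, ∞)³`. -/
noncomputable def mulHaar3 : Measure (ℝ × ℝ × ℝ) :=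
  mulHaar.prod (mulHaar.prod mulHaar)

instance : SigmaFinite mulHaar3 :=
  inferInstanceAs (SigmaFinite (mulHaar.prod (mulHaar.prod mulHaar)))

/-- The `t`-independent part of the denominator of the Feynman integrand. -/
noncomputable def feynmanDenom (x : ℝ × ℝ × ℝ) : ℝ :=
  (1 + x.1 + x.2.1 + x.2.2) * (1 + x.1⁻¹ + x.2.1⁻¹ + x.2.2⁻¹)

theorem measurable_feynmanDenom : Measurable feynmanDenom := by
  unfold feynmanDenom
  fun_prop

theorem ae_mulHaar3_pos : ∀ᵐ x ∂mulHaar3, 0 < x.1 ∧ 0 < x.2.1 ∧ 0 < x.2.2 := by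
  have h2 : ∀ᵐ y ∂(mulHaar.prod mulHaar), 0 < y.1 ∧ 0 < y.2 :=
    (Measure.quasiMeasurePreserving_fst.ae ae_mulHaar_pos).and
      (Measure.quasiMeasurePreserving_snd.ae ae_mulHaar_pos)
  exact (Measure.quasiMeasurePreserving_fst.ae ae_mulHaar_pos).and
    (Measure.quasiMeasurePreserving_snd.ae h2)

theorem ae_lt_feynmanDenom : ∀ᵐ x ∂mulHaar3, 16 < feynmanDenom x := by
  have h1 : ∀ᵐ x ∂mulHaar3, x.1 ≠ 1 :=
    Measure.quasiMeasurePreserving_fst.ae (ae_mulHaar_ne 1)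
  filter_upwards [ae_mulHaar3_pos, h1] with ⟨a, b, c⟩ ⟨ha, hb, hc⟩ hne
  simp only at ha hb hc hne
  have h : feynmanDenom (a, b, c) = 16 + ((a - 1) ^ 2 / a + (b - 1) ^ 2 / b + (c - 1) ^ 2 / c +
      (a - b) ^ 2 / (a * b) + (a - c) ^ 2 / (a * c) + (b - c) ^ 2 / (b * c)) := by
    simp only [feynmanDenom]
    field_simp
    ring
  rw [h]
  have : 0 < (a - 1) ^ 2 := by
    have := sub_ne_zero.2 hne
    positivity
  have : 0 < (a - 1) ^ 2 / a + (b - 1) ^ 2 / b + (c - 1) ^ 2 / c +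
      (a - b) ^ 2 / (a * b) + (a - c) ^ 2 / (a * c) + (b - c) ^ 2 / (b * c) := by positivity
  linarith

/-- A product of four kernels of `besselIntegral 1`; integrating out `l` and `w` yields a power of
`feynmanDenom x`. -/
noncomputable def besselKernel (n : ℕ) (x : ℝ × ℝ × ℝ) (l w : ℝ) : ENNReal :=
  ENNReal.ofReal (w ^ (n + 1)) * ENNReal.ofReal (Real.exp (-l - w / l)) *
    (ENNReal.ofReal (Real.exp (-(l * x.1) - w / (l * x.1))) *
      (ENNReal.ofReal (Real.exp (-(l * x.2.1) - w / (l * x.2.1))) *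
        ENNReal.ofReal (Real.exp (-(l * x.2.2) - w / (l * x.2.2)))))

theorem measurable_besselKernel (n : ℕ) :
    Measurable fun p : (ℝ × ℝ × ℝ) × ℝ × ℝ => besselKernel n p.1 p.2.1 p.2.2 := by
  unfold besselKernel
  fun_prop

theorem lintegral_lintegral_besselKernel (n : ℕ) {x : ℝ × ℝ × ℝ}
    (hx : 0 < x.1 ∧ 0 < x.2.1 ∧ 0 < x.2.2) :
    ∫⁻ l, ∫⁻ w, besselKernel n x l w ∂mulHaar ∂mulHaar =
      ENNReal.ofReal (n.factorial ^ 2 * (feynmanDenom x)⁻¹ ^ (n + 1)) := by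
  obtain ⟨a, b, c⟩ := x
  obtain ⟨ha, hb, hc⟩ := hx
  simp only at ha hb hc
  have hA : 0 < 1 + a + b + c := by positivity
  have hB : 0 < 1 + a⁻¹ + b⁻¹ + c⁻¹ := by positivity
  have hin : ∀ l : ℝ, 0 < l → ∫⁻ w, besselKernel n (a, b, c) l w ∂mulHaar =
      ENNReal.ofReal (n.factorial * (1 + a⁻¹ + b⁻¹ + c⁻¹)⁻¹ ^ (n + 1)) *
        ENNReal.ofReal (l ^ (n + 1) * Real.exp (-((1 + a + b + c) * l))) := by
    intro l hl
    have hk : ∀ w : ℝ, besselKernel n (a, b, c) l w =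
        ENNReal.ofReal (Real.exp (-((1 + a + b + c) * l))) *
          ENNReal.ofReal (w ^ (n + 1) * Real.exp (-((1 + a⁻¹ + b⁻¹ + c⁻¹) / l * w))) := by
      intro w
      have hexp : Real.exp (-l - w / l) * (Real.exp (-(l * a) - w / (l * a)) *
          (Real.exp (-(l * b) - w / (l * b)) * Real.exp (-(l * c) - w / (l * c)))) =
          Real.exp (-((1 + a + b + c) * l)) *
            Real.exp (-((1 + a⁻¹ + b⁻¹ + c⁻¹) / l * w)) := by
        simp only [← Real.exp_add]
        congr 1
        field_simp
        ring
      simp only [besselKernel]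
      rw [mul_assoc, ← ENNReal.ofReal_mul (by positivity), ← ENNReal.ofReal_mul (by positivity),
        ← ENNReal.ofReal_mul (by positivity), hexp, ENNReal.ofReal_mul (by positivity),
        ENNReal.ofReal_mul' (by positivity)]
      ring
    simp_rw [hk]
    rw [lintegral_const_mul _ (by fun_prop), lintegral_mulHaar_pow_mul_exp n (by positivity),
      ← ENNReal.ofReal_mul (by positivity), ← ENNReal.ofReal_mul (by positivity), inv_div, div_pow,
      inv_pow]
    congr 1
    field_simp
  rw [lintegral_congr_ae (ae_mulHaar_pos.mono hin), lintegral_const_mul _ (by fun_prop),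
    lintegral_mulHaar_pow_mul_exp n hA, ← ENNReal.ofReal_mul (by positivity)]
  congr 1
  simp only [feynmanDenom, mul_inv, mul_pow]
  ring

theorem lintegral_besselKernel (n : ℕ) {l : ℝ} (hl : 0 < l) (w : ℝ) :
    ∫⁻ x, besselKernel n x l w ∂mulHaar3 =
      ENNReal.ofReal (w ^ (n + 1)) * ENNReal.ofReal (Real.exp (-l - w / l)) *
        (∫⁻ y, ENNReal.ofReal (Real.exp (-y - w / y)) ∂mulHaar) ^ 3 := by
  have hs := lintegral_mulHaar_comp_mul_left
    (f := fun y => ENNReal.ofReal (Real.exp (-y - w / y))) (by fun_prop) hl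
  have hf : AEMeasurable (fun y : ℝ => ENNReal.ofReal (Real.exp (-(l * y) - w / (l * y))))
    mulHaar := by fun_prop
  simp only [besselKernel]
  rw [lintegral_const_mul _ (by fun_prop), mulHaar3, lintegral_prod_mul hf (g := fun y : ℝ × ℝ =>
      ENNReal.ofReal (Real.exp (-(l * y.1) - w / (l * y.1))) *
        ENNReal.ofReal (Real.exp (-(l * y.2) - w / (l * y.2)))) (by fun_prop),
    lintegral_prod_mul hf hf, hs]
  ring

theorem lintegral_lintegral_lintegral_rotate {α β γ : Type*} [MeasurableSpace α]
    [MeasurableSpace β] [MeasurableSpace γ] {μ : Measure α} {ν : Measure β} {τ : Measure γ}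
    [SFinite μ] [SFinite ν] [SFinite τ] {k : α → β → γ → ENNReal}
    (hk : Measurable fun p : α × β × γ => k p.1 p.2.1 p.2.2) :
    ∫⁻ x, ∫⁻ l, ∫⁻ w, k x l w ∂τ ∂ν ∂μ = ∫⁻ w, ∫⁻ l, ∫⁻ x, k x l w ∂μ ∂ν ∂τ := by
  have h1 : Measurable fun q : (α × β) × γ => k q.1.1 q.1.2 q.2 :=
    hk.comp (measurable_fst.fst.prodMk (measurable_fst.snd.prodMk measurable_snd))
  have h2 : ∀ l, Measurable fun q : α × γ => k q.1 l q.2 := fun l =>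
    hk.comp (measurable_fst.prodMk (measurable_const.prodMk measurable_snd))
  have h3 : Measurable fun q : α × β => ∫⁻ w, k q.1 q.2 w ∂τ := h1.lintegral_prod_right'
  have h4 : Measurable fun q : β × γ => ∫⁻ x, k x q.1 q.2 ∂μ := hk.lintegral_prod_left'
  rw [lintegral_lintegral_swap (f := fun x l => ∫⁻ w, k x l w ∂τ) h3.aemeasurable,
    lintegral_lintegral_swap (f := fun w l => ∫⁻ x, k x l w ∂μ)
      (h4.comp measurable_swap).aemeasurable]
  exact lintegral_congr fun l => lintegral_lintegral_swap (f := fun x w => k x l w)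
    (h2 l).aemeasurable

theorem lintegral_inv_feynmanDenom_pow (n : ℕ) :
    ∫⁻ x, ENNReal.ofReal (n.factorial ^ 2 * (feynmanDenom x)⁻¹ ^ (n + 1)) ∂mulHaar3 =
      ENNReal.ofReal (besselMoment n) := by
  rw [← lintegral_congr_ae (ae_mulHaar3_pos.mono fun x hx => lintegral_lintegral_besselKernel n hx),
    lintegral_lintegral_lintegral_rotate (measurable_besselKernel n),
    ← lintegral_mulHaar_besselIntegral n]
  refine lintegral_congr fun w => ?_
  rw [lintegral_congr_ae (ae_mulHaar_pos.mono fun l hl => lintegral_besselKernel n hl w),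
    lintegral_mul_const _ (by fun_prop), lintegral_const_mul _ (by fun_prop)]
  ring

theorem besselMoment_nonneg (n : ℕ) : 0 ≤ besselMoment n :=
  setIntegral_nonneg measurableSet_Ioi fun w (hw : 0 < w) =>
    mul_nonneg (by positivity) ((show Even 4 by decide).pow_nonneg _)

theorem integrable_inv_feynmanDenom_pow (n : ℕ) :
    Integrable (fun x => (feynmanDenom x)⁻¹ ^ (n + 1)) mulHaar3 ∧
      (n.factorial : ℝ) ^ 2 * ∫ x, (feynmanDenom x)⁻¹ ^ (n + 1) ∂mulHaar3 = besselMoment n := by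
  have hm := measurable_feynmanDenom
  have hnn : 0 ≤ᵐ[mulHaar3] fun x => (n.factorial : ℝ) ^ 2 * (feynmanDenom x)⁻¹ ^ (n + 1) :=
    ae_lt_feynmanDenom.mono fun x hx => by
      have : 0 < feynmanDenom x := by linarith
      simp only [Pi.zero_apply]
      positivity
  have hlin := lintegral_inv_feynmanDenom_pow n
  have hint : Integrable (fun x => (n.factorial : ℝ) ^ 2 * (feynmanDenom x)⁻¹ ^ (n + 1))
      mulHaar3 := by
    refine ⟨by fun_prop, ?_⟩
    rw [hasFiniteIntegral_iff_ofReal hnn, hlin]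
    exact ENNReal.ofReal_lt_top
  have hfac : (n.factorial : ℝ) ^ 2 ≠ 0 := by
    have := Nat.factorial_ne_zero n
    positivity
  refine ⟨(integrable_const_mul_iff (isUnit_iff_ne_zero.2 hfac) _).1 hint, ?_⟩
  rw [← integral_const_mul, integral_eq_lintegral_of_nonneg_ae hnn hint.1, hlin,
    ENNReal.toReal_ofReal (besselMoment_nonneg n)]

theorem feynmanI_eq_integral {t : ℝ}
    (ht : Integrable (fun x => (feynmanDenom x - t)⁻¹) mulHaar3) :
    feynmanI t = ∫ x, (feynmanDenom x - t)⁻¹ ∂mulHaar3 := by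
  rw [mulHaar3] at ht ⊢
  rw [integral_prod _ ht, integral_congr_ae (ht.prod_right_ae.mono fun x hx => integral_prod _ hx)]
  simp only [integral_mulHaar, ← integral_const_mul, feynmanDenom, feynmanI]
  refine integral_congr_ae (.of_forall fun x => integral_congr_ae (.of_forall fun y =>
    integral_congr_ae (.of_forall fun z => ?_)))
  simp only [div_eq_mul_inv, mul_inv]
  ring

/-- The image of the Haar measure on `(0, ∞)³` under `x ↦ feynmanDenom x - 16`. -/
noncomputable def energyMeasure : Measure ℝ :=
  mulHaar3.map fun x => feynmanDenom x - 16

theorem measurable_feynmanDenom_sub : Measurable fun x => feynmanDenom x - 16 :=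
  measurable_feynmanDenom.sub_const 16

theorem ae_energyMeasure_pos : ∀ᵐ e ∂energyMeasure, 0 < e :=
  (ae_map_iff measurable_feynmanDenom_sub.aemeasurable measurableSet_Ioi).2
    (ae_lt_feynmanDenom.mono fun _ hx => sub_pos.2 hx)

theorem integral_energyMeasure_pow (n : ℕ) :
    (n.factorial : ℝ) ^ 2 * ∫ e, (e + 16)⁻¹ ^ (n + 1) ∂energyMeasure = besselMoment n := by
  rw [energyMeasure, integral_map measurable_feynmanDenom_sub.aemeasurable
    (by fun_prop : Measurable fun e : ℝ => (e + 16)⁻¹ ^ (n + 1)).aestronglyMeasurable]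
  simp only [sub_add_cancel]
  exact (integrable_inv_feynmanDenom_pow n).2

theorem integrable_energyMeasure : Integrable (fun e => (e + 16)⁻¹) energyMeasure := by
  rw [energyMeasure, integrable_map_measure
    (by fun_prop : Measurable fun e : ℝ => (e + 16)⁻¹).aestronglyMeasurable
    measurable_feynmanDenom_sub.aemeasurable]
  simpa [Function.comp_def] using (integrable_inv_feynmanDenom_pow 0).1

theorem feynmanI_eq_integral_energyMeasure {t a : ℝ} (hta : t + a = 16)
    (h : Integrable (fun e => (e + a)⁻¹) energyMeasure) :
    feynmanI t = ∫ e, (e + a)⁻¹ ∂energyMeasure := by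
  have hm := (by fun_prop : Measurable fun e : ℝ => (e + a)⁻¹).aestronglyMeasurable
    (μ := energyMeasure)
  have hf : ∀ x, feynmanDenom x - 16 + a = feynmanDenom x - t := fun x => by linarith
  rw [energyMeasure] at h hm ⊢
  rw [integrable_map_measure hm measurable_feynmanDenom_sub.aemeasurable] at h
  rw [integral_map measurable_feynmanDenom_sub.aemeasurable hm]
  simp only [Function.comp_def, hf] at h ⊢
  exact feynmanI_eq_integral h

theorem feynmanI_relations :
    feynmanI 16 = 2 * feynmanI 4 ∧
      feynmanI 16 = 8 * (feynmanI (-2) - feynmanI (-32)) := by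
  have hpos := ae_energyMeasure_pos
  have hint := integrable_energyMeasure
  obtain ⟨h0, h1, h2⟩ := integral_inv_add_relations_of_recurrence hpos hint fun n => by
    have hr := besselMoment_recurrence n
    rw [← integral_energyMeasure_pow, ← integral_energyMeasure_pow, ← integral_energyMeasure_pow,
      Nat.factorial_succ, Nat.factorial_succ] at hr
    have hfac : (n.factorial : ℝ) ^ 2 * ((n : ℝ) + 1) ^ 2 ≠ 0 := by
      have := Nat.factorial_ne_zero n
      positivity
    refine (mul_eq_zero.1 (Eq.trans ?_ hr)).resolve_left hfac
    push_cast
    ring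
  have hnn : ∀ᵐ e ∂energyMeasure, 0 ≤ e := hpos.mono fun e he => he.le
  have e16 := feynmanI_eq_integral_energyMeasure (t := 16) (a := 0) (by norm_num)
    (by simpa using h0)
  have e4 := feynmanI_eq_integral_energyMeasure (t := 4) (a := 12) (by norm_num)
    (integrable_inv_add hnn hint (by norm_num))
  have e2 := feynmanI_eq_integral_energyMeasure (t := -2) (a := 18) (by norm_num)
    (integrable_inv_add hnn hint (by norm_num))
  have e32 := feynmanI_eq_integral_energyMeasure (t := -32) (a := 48) (by norm_num)
    (integrable_inv_add hnn hint (by norm_num))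
  simp only [add_zero] at e16
  constructor <;> linarith
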